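/- arXiv:2211.11456 — 10 statements merged into one kernel-verified Lean document; each statement's English description precedes it below -/
import Mathlib

section
/- Let F be a field of characteristic different from 3 that contains no nontrivial cube root of unity. Let A be a central simple F-algebra with dim_F A = 9. Then the quotient group A^×/F^× contains no subgroup isomorphic to (ℤ/3ℤ)²; that is, there is no injective group homomorphism from (ℤ/3ℤ)² into A^×/F^×. -/
/-- The subgroup `{c·1 : c ∈ F^×}` of scalar units inside the unit group `Aˣ`
of an `F`-algebra `A`. The quotient `Aˣ ⧸ projUnits F A` is the group `A^×/F^×`. -/
def projUnits (F A : Type*) [Field F] [Ring A] [Algebra F A] : Subgroup Aˣ :=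
  (Units.map (algebraMap F A).toMonoidHom).range

instance projUnits_normal (F A : Type*) [Field F] [Ring A] [Algebra F A] :
    (projUnits F A).Normal := by
  constructor
  rintro n ⟨c, rfl⟩ g
  refine ⟨c, ?_⟩
  ext
  push_cast [Units.val_mul]
  calc (algebraMap F A) c = (algebraMap F A c * ↑g) * ↑g⁻¹ := by
        rw [mul_assoc, Units.mul_inv, mul_one]
    _ = ↑g * (algebraMap F A) c * ↑g⁻¹ := by rw [Algebra.commutes]

section aux
open Polynomial

theorem aux_dvd {F K V : Type*} [Field F] [Field K] [Algebra F K] [AddCommGroup V] [Module F V]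
    (φ : K →ₐ[F] Module.End F V) : Module.finrank F K ∣ Module.finrank F V := by
  let : Module K V := Module.compHom V φ.toRingHom
  have h : ∀ (k : K) (v : V), k • v = φ k v := fun _ _ => rfl
  have : IsScalarTower F K V := ⟨fun c k v => by simp [h]⟩
  exact ⟨_, (Module.finrank_mul_finrank F K V).symm⟩

theorem aux_irr {F : Type*} [Field F] (hchar : (3 : F) ≠ 0)
    (hcube : ∀ x : F, x ^ 3 = 1 → x = 1) : Irreducible (X ^ 2 + X + 1 : F[X]) := by
  have hm : (X ^ 2 + X + 1 : F[X]).Monic := by monicity!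
  have hd : (X ^ 2 + X + 1 : F[X]).natDegree = 2 := by compute_degree!
  rw [hm.irreducible_iff_roots_eq_zero_of_degree_le_three (by omega) (by omega)]
  refine Multiset.eq_zero_of_forall_notMem fun t ht => ?_
  have h0 : t ^ 2 + t + 1 = 0 := by simpa using (mem_roots'.1 ht).2
  have h1 : t = 1 := hcube t (by linear_combination (t - 1) * h0)
  subst h1
  apply hchar
  linear_combination h0

theorem aux_even {F V : Type*} [Field F] [AddCommGroup V] [Module F V]
    (hchar : (3 : F) ≠ 0) (hcube : ∀ x : F, x ^ 3 = 1 → x = 1)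
    (J : Module.End F V) (hJ : J ^ 2 + J + 1 = 0) : 2 ∣ Module.finrank F V := by
  have : Fact (Irreducible (X ^ 2 + X + 1 : F[X])) := ⟨aux_irr hchar hcube⟩
  have hm : (X ^ 2 + X + 1 : F[X]).Monic := by monicity!
  have hd : (X ^ 2 + X + 1 : F[X]).natDegree = 2 := by compute_degree!
  have hf : Module.finrank F (AdjoinRoot (X ^ 2 + X + 1 : F[X])) = 2 := by
    rw [(AdjoinRoot.powerBasis' hm).finrank]; simpa using hd
  rw [← hf]
  let ψ : F[X] →ₐ[F] Module.End F V := aeval J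
  exact aux_dvd (Ideal.Quotient.liftₐ (Ideal.span {(X ^ 2 + X + 1 : F[X])}) ψ (by
    intro a ha
    obtain ⟨c, rfl⟩ := Ideal.mem_span_singleton'.1 ha
    simp [ψ, hJ]))

theorem aux_parity {F V : Type*} [Field F] [AddCommGroup V] [Module F V] [FiniteDimensional F V]
    (hchar : (3 : F) ≠ 0) (hcube : ∀ x : F, x ^ 3 = 1 → x = 1)
    (J : Module.End F V) (hJ : J ^ 3 = 1) :
    ∃ k, Module.finrank F V = 2 * k + Module.finrank F (LinearMap.ker (J - 1)) := by
  have hJ' : ∀ v, J (J (J v)) = v := fun v => by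
    have := LinearMap.congr_fun hJ v
    simpa [pow_succ] using this
  have h := (J - 1).finrank_range_add_finrank_ker
  have hm : ∀ v ∈ LinearMap.range (J - 1), J v ∈ LinearMap.range (J - 1) := by
    rintro _ ⟨v, rfl⟩
    exact ⟨J v, by simp⟩
  obtain ⟨k, hk⟩ := aux_even hchar hcube (J.restrict hm) (by
    ext ⟨_, v, rfl⟩
    simp [pow_succ, hJ'])
  exact ⟨k, by omega⟩

/-- commuting elements of order three in 3x3 matrices -/
theorem aux_mat {F V : Type*} [Field F] [AddCommGroup V] [Module F V] [FiniteDimensional F V]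
    (hchar : (3 : F) ≠ 0) (hcube : ∀ x : F, x ^ 3 = 1 → x = 1)
    (hV : Module.finrank F V = 3) (x y : Module.End F V) (hx : x ^ 3 = 1) (hy : y ^ 3 = 1)
    (hxy : Commute x y) (h0 : x ≠ 1) (h1 : x * y ≠ 1) (h2 : x * y ^ 2 ≠ 1) : y = 1 := by
  have key : ∀ p : Module.End F V, p ^ 3 = 1 → Commute p y → p ≠ 1 →
      (y - 1) * (1 + p + p ^ 2) = 0 := by
    intro p hp hpy hp1
    obtain ⟨k, hk⟩ := aux_parity hchar hcube p hp
    have hne : Module.finrank F (LinearMap.ker (p - 1)) ≠ 3 := by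
      intro h
      have : LinearMap.ker (p - 1) = ⊤ := Submodule.eq_top_of_finrank_eq (by omega)
      exact hp1 (sub_eq_zero.1 (LinearMap.ker_eq_top.1 this))
    have hone : Module.finrank F (LinearMap.ker (p - 1)) = 1 := by omega
    obtain ⟨v, hv0, hv⟩ := finrank_eq_one_iff'.1 hone
    have hpy' : ∀ w, p (y w) = y (p w) := fun w => LinearMap.congr_fun hpy w
    have hy' : ∀ v, y (y (y v)) = v := fun v => by
      have := LinearMap.congr_fun hy v
      simpa [pow_succ] using this
    have hp' : ∀ v, p (p (p v)) = v := fun v => by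
      have := LinearMap.congr_fun hp v
      simpa [pow_succ] using this
    have hv1 : p v = v := by
      have h := LinearMap.mem_ker.1 v.2
      rw [LinearMap.sub_apply, Module.End.one_apply] at h
      exact sub_eq_zero.1 h
    have hmem : ∀ w, p w = w → ∃ c : F, c • (v : V) = w := by
      intro w hw
      obtain ⟨c, hc⟩ := hv ⟨w, by simp [hw]⟩
      exact ⟨c, congrArg Subtype.val hc⟩
    obtain ⟨c, hc⟩ := hmem (y v) (by rw [hpy', hv1])
    have hv0' : (v : V) ≠ 0 := fun h => hv0 (Subtype.ext h)
    have hc3 : c ^ 3 = 1 := by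
      have h3 := hy' v
      rw [← hc, map_smul, ← hc, map_smul, map_smul, ← hc, smul_smul, smul_smul] at h3
      have : (c * (c * c) - 1) • (v : V) = 0 := by
        rw [sub_smul, one_smul, ← mul_assoc, h3, sub_self]
      rcases smul_eq_zero.1 this with h | h
      · linear_combination h
      · exact absurd h hv0'
    have hc1 := hcube c hc3
    subst hc1
    rw [one_smul] at hc
    ext w
    obtain ⟨d, hd⟩ := hmem ((1 + p + p ^ 2 : Module.End F V) w) (by
      simp [pow_succ, hp']; abel)
    rw [Module.End.mul_apply, ← hd]
    simp [← hc]
  have e1 := key x hx hxy h0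
  have e2 := key (x * y) (by rw [hxy.mul_pow, hx, hy, one_mul]) (hxy.mul_left (Commute.refl y)) h1
  have e3 := key (x * y ^ 2) (by
    rw [(hxy.pow_right 2).mul_pow, hx, ← pow_mul, mul_comm, pow_mul, hy, one_pow, one_mul])
    (hxy.mul_left ((Commute.refl y).pow_left 2)) h2
  have c1 : (x * y) ^ 2 = x ^ 2 * y ^ 2 := hxy.mul_pow 2
  have c2 : (x * y ^ 2) ^ 2 = x ^ 2 * y := by
    rw [(hxy.pow_right 2).mul_pow, ← pow_mul, show 2 * 2 = 3 + 1 from rfl, pow_succ y, hy, one_mul]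
  rw [c1] at e2
  rw [c2] at e3
  have e4 : (y - 1) * (1 + y + y ^ 2) = 0 := by
    have : (y - 1) * (1 + y + y ^ 2) = y ^ 3 - 1 := by noncomm_ring
    rw [this, hy, sub_self]
  have e5 : (y - 1) * (1 + x + x ^ 2) * (1 + y + y ^ 2) = 0 := by rw [e1, zero_mul]
  have e6 : (3 : F) • (y - 1) = (y - 1) * (1 + x + x ^ 2) + (y - 1) * (1 + x * y + x ^ 2 * y ^ 2)
      + (y - 1) * (1 + x * y ^ 2 + x ^ 2 * y) + (y - 1) * (1 + y + y ^ 2)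
      - (y - 1) * (1 + x + x ^ 2) * (1 + y + y ^ 2) := by
    rw [show (3 : F) = 1 + 1 + 1 by norm_num, add_smul, add_smul, one_smul]
    noncomm_ring
  rw [e1, e2, e3, e4] at e6
  simp only [zero_mul, add_zero, sub_zero] at e6
  exact sub_eq_zero.1 ((smul_eq_zero.1 e6).resolve_left hchar)

theorem aux_cube {F A : Type*} [Field F] [Ring A] [Algebra F A]
    (hchar : (3 : F) ≠ 0) (hcube : ∀ x : F, x ^ 3 = 1 → x = 1) [IsSimpleRing A]
    (hdim : Module.finrank F A = 9) (x y : A) (hx : x ^ 3 = 1) (hy : y ^ 3 = 1)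
    (hxy : Commute x y) (h0 : x ≠ 1) (h1 : x * y ≠ 1) (h2 : x * y ^ 2 ≠ 1) : y = 1 := by
  have : FiniteDimensional F A := Module.finite_of_finrank_pos (by omega)
  have : IsArtinianRing A := IsArtinianRing.of_finite F A
  obtain ⟨n, hn, D, i1, i2, i3, ⟨e⟩⟩ :=
    IsSimpleRing.exists_algEquiv_matrix_divisionRing_finite F A
  have hd := e.toLinearEquiv.finrank_eq
  rw [hdim, Module.finrank_matrix] at hd
  simp only [Fintype.card_fin] at hd
  have hn3 : n ≤ 3 := by
    by_contra hcon
    have hD : 0 < Module.finrank F D := Module.finrank_pos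
    have : 4 * 4 ≤ n * n := Nat.mul_le_mul (by omega) (by omega)
    nlinarith
  have hn0 := hn.out
  obtain rfl | rfl | rfl : n = 1 ∨ n = 2 ∨ n = 3 := by omega
  · exfalso
    obtain ⟨e'⟩ : Nonempty (Matrix (Fin 1) (Fin 1) D ≃ₐ[F] D) := by
      convert Nonempty.intro (Matrix.uniqueAlgEquiv (m := Fin 1) (R := F) (A := D))
    let g := e.trans e'
    have hgx : g x ≠ 1 := fun h => h0 (g.injective (by rw [h, map_one]))
    have hg3 : g x ^ 3 = 1 := by rw [← map_pow, hx, map_one]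
    have hprod : (g x - 1) * (g x ^ 2 + g x + 1) = 0 := by
      have : (g x - 1) * (g x ^ 2 + g x + 1) = g x ^ 3 - 1 := by noncomm_ring
      rw [this, hg3, sub_self]
    have hq := (mul_eq_zero.1 hprod).resolve_left (sub_ne_zero.2 hgx)
    have h2 := aux_even hchar hcube (Algebra.lmul F D (g x)) (by
      rw [← map_pow, ← map_add, ← map_one (Algebra.lmul F D), ← map_add, hq, map_zero])
    omega
  · omega
  · have hD1 : Module.finrank F D = 1 := by omega
    have hb : Function.Bijective (Algebra.ofId F D) :=
      ⟨(algebraMap F D).injective, fun d => by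
        obtain ⟨c, hc⟩ := (finrank_eq_one_iff_of_nonzero' (1 : D) one_ne_zero).1 hD1 d
        exact ⟨c, by rw [← hc, Algebra.smul_def, mul_one]; rfl⟩⟩
    let g := (e.trans (AlgEquiv.ofBijective _ hb).symm.mapMatrix).trans Matrix.toLinAlgEquiv'
    have inj : ∀ z, z ≠ 1 → g z ≠ 1 := fun z hz h => hz (g.injective (by rw [h, map_one]))
    have := aux_mat hchar hcube (V := Fin 3 → F) (by simp) (g x) (g y)
      (by rw [← map_pow, hx, map_one]) (by rw [← map_pow, hy, map_one]) (hxy.map g)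
      (inj x h0) (by rw [← map_mul]; exact inj _ h1)
      (by rw [← map_pow, ← map_mul]; exact inj _ h2)
    exact g.injective (by rw [this, map_one])

theorem aux_noncube {F A : Type*} [Field F] [Ring A] [Algebra F A]
    (hchar : (3 : F) ≠ 0) (hcube : ∀ x : F, x ^ 3 = 1 → x = 1) [Algebra.IsCentral F A]
    (hdim : Module.finrank F A = 9) (x y : Aˣ) (a b : F) (hx : (x : A) ^ 3 = algebraMap F A a)
    (hy : (y : A) ^ 3 = algebraMap F A b) (hxy : Commute (x : A) y)
    (ha : ∀ c : F, c ^ 3 ≠ a) (hxs : ∀ c : F, (x : A) ≠ algebraMap F A c) :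
    ∃ s : F, (y : A) = algebraMap F A s ∨ (y : A) = algebraMap F A s * x ∨
      (y : A) = algebraMap F A s * x ^ 2 := by
  have : FiniteDimensional F A := Module.finite_of_finrank_pos (by omega)
  have : Nontrivial A := Module.nontrivial_of_finrank_pos (R := F) (by omega)
  have hirr : Irreducible (X ^ 3 - C a : F[X]) :=
    X_pow_sub_C_irreducible_of_prime Nat.prime_three ha
  have : Fact (Irreducible (X ^ 3 - C a : F[X])) := ⟨hirr⟩
  have hm : (X ^ 3 - C a : F[X]).Monic := by monicity!
  have hd : (X ^ 3 - C a : F[X]).natDegree = 3 := by compute_degree!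
  have hf : Module.finrank F (AdjoinRoot (X ^ 3 - C a : F[X])) = 3 := by
    rw [(AdjoinRoot.powerBasis' hm).finrank]; simpa using hd
  let S := Subalgebra.centralizer F {(x : A)}
  have hS : ∀ z : A, z ∈ S ↔ (x : A) * z = z * x := fun z => by
    simp [S, Subalgebra.mem_centralizer_iff]
  let x' : S := ⟨x, (hS _).2 rfl⟩
  let φ : AdjoinRoot (X ^ 3 - C a : F[X]) →ₐ[F] S :=
    Ideal.Quotient.liftₐ (Ideal.span {(X ^ 3 - C a : F[X])}) (aeval x') (by
      intro p hp
      obtain ⟨c, rfl⟩ := Ideal.mem_span_singleton'.1 hp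
      have : aeval x' (X ^ 3 - C a) = 0 := by
        apply Subtype.ext
        simp [x', hx]
      rw [map_mul, this, mul_zero])
  have hφ : ∀ p, φ (AdjoinRoot.mk _ p) = aeval x' p := fun p => rfl
  have hdvd := aux_dvd ((Algebra.lmul F S).comp φ)
  rw [hf] at hdvd
  -- conjugation
  let J : Module.End F A := LinearMap.mulLeft F (x : A) ∘ₗ LinearMap.mulRight F (↑x⁻¹ : A)
  have hJ : ∀ z, J z = x * (z * ↑x⁻¹) := fun z => rfl
  have hJ3 : J ^ 3 = 1 := by
    ext z
    have : (J ^ 3) z = (x : A) ^ 3 * z * (↑x⁻¹ : A) ^ 3 := by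
      simp [pow_succ, hJ, mul_assoc]
    rw [this, hx, Algebra.commutes, ← hx, mul_assoc, ← Units.val_pow_eq_pow_val,
      ← Units.val_pow_eq_pow_val, ← Units.val_mul, inv_pow, mul_inv_cancel]
    simp
  obtain ⟨k, hk⟩ := aux_parity hchar hcube J hJ3
  have hker : LinearMap.ker (J - 1) = Subalgebra.toSubmodule S := by
    ext z
    rw [LinearMap.mem_ker, Subalgebra.mem_toSubmodule, hS, LinearMap.sub_apply, sub_eq_zero, hJ,
      Module.End.one_apply, ← mul_assoc, Units.mul_inv_eq_iff_eq_mul]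
  rw [hker, hdim, Subalgebra.finrank_toSubmodule] at hk
  have hne : Module.finrank F S ≠ 9 := by
    intro h
    have htop : S = ⊤ := by
      apply Subalgebra.toSubmodule_injective
      rw [Algebra.top_toSubmodule]
      exact Submodule.eq_top_of_finrank_eq (by rw [Subalgebra.finrank_toSubmodule, h, hdim])
    have hc : (x : A) ∈ Subalgebra.center F A := by
      rw [Subalgebra.mem_center_iff]
      intro z
      exact ((hS z).1 (htop ▸ Algebra.mem_top)).symm
    obtain ⟨c, hc⟩ := (Algebra.IsCentral.mem_center_iff F).1 hc
    exact hxs c hc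
  have h3 : Module.finrank F S = 3 := by omega
  have hinj : Function.Injective φ.toLinearMap := φ.toRingHom.injective
  have : FiniteDimensional F (AdjoinRoot (X ^ 3 - C a : F[X])) :=
    Module.finite_of_finrank_pos (by omega)
  have hsurj := (LinearMap.injective_iff_surjective_of_finrank_eq_finrank
    (by rw [hf, h3])).1 hinj
  obtain ⟨w, hw⟩ := hsurj ⟨y, (hS _).2 hxy⟩
  obtain ⟨P, rfl⟩ := AdjoinRoot.mk_surjective w
  let Q := P %ₘ (X ^ 3 - C a)
  have hQ : AdjoinRoot.mk (X ^ 3 - C a) Q = AdjoinRoot.mk (X ^ 3 - C a) P := by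
    rw [AdjoinRoot.mk_eq_mk]
    have h := modByMonic_add_div P (X ^ 3 - C a)
    exact ⟨- (P /ₘ (X ^ 3 - C a)), by linear_combination h⟩
  have hQd : Q.natDegree < 3 := by
    have h := natDegree_modByMonic_lt P hm (by intro h; rw [h] at hd; simp at hd)
    rwa [hd] at h
  obtain ⟨p, q, r, hpqr⟩ : ∃ p q r : F, Q = C p + C q * X + C r * X ^ 2 := by
    refine ⟨Q.coeff 0, Q.coeff 1, Q.coeff 2, ?_⟩
    conv_lhs => rw [Q.as_sum_range_C_mul_X_pow' hQd]
    simp [Finset.sum_range_succ]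
  have hyx : (y : A) = algebraMap F A p + algebraMap F A q * x + algebraMap F A r * x ^ 2 := by
    have h : φ (AdjoinRoot.mk _ P) = ⟨y, (hS _).2 hxy⟩ := hw
    rw [← hQ, hφ, hpqr] at h
    have h := congrArg Subtype.val h
    simp [x'] at h
    exact h.symm
  have hcubeQ : (X ^ 3 - C a) ∣ Q ^ 3 - C b := by
    rw [← AdjoinRoot.mk_eq_zero, map_sub, map_pow, hQ]
    apply φ.toRingHom.injective
    have h : φ (AdjoinRoot.mk _ P) = ⟨y, (hS _).2 hxy⟩ := hw
    change φ _ = φ _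
    rw [map_sub, map_pow, h, map_zero, hφ]
    apply Subtype.ext
    simp [hy]
  let u := p ^ 3 + a * q ^ 3 + a ^ 2 * r ^ 3 + 6 * a * p * q * r - b
  let v := 3 * (p ^ 2 * q + a * p * r ^ 2 + a * q ^ 2 * r)
  let t := 3 * (p ^ 2 * r + p * q ^ 2 + a * q * r ^ 2)
  have hdv : (X ^ 3 - C a) ∣ (C u + C v * X + C t * X ^ 2 : F[X]) := by
    have : (C u + C v * X + C t * X ^ 2 : F[X]) = (Q ^ 3 - C b) - (X ^ 3 - C a) *
      (C q ^ 3 + C r ^ 3 * (X ^ 3 + C a) + 6 * C p * C q * C r + 3 * (C p * C r ^ 2 + C q ^ 2 * C r) * X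
        + 3 * C q * C r ^ 2 * X ^ 2) := by
      rw [hpqr]
      simp only [u, v, t, map_add, map_sub, map_mul, map_pow, map_ofNat]
      ring
    rw [this]
    exact dvd_sub hcubeQ (dvd_mul_right _ _)
  have hz : (C u + C v * X + C t * X ^ 2 : F[X]) = 0 := by
    apply eq_zero_of_dvd_of_natDegree_lt hdv
    rw [hd]
    have : (C u + C v * X + C t * X ^ 2 : F[X]).natDegree ≤ 2 := by compute_degree
    omega
  have hv : v = 0 := by simpa [coeff_X, coeff_C, coeff_X_pow] using congrArg (coeff · 1) hz
  have ht : t = 0 := by simpa [coeff_X, coeff_C, coeff_X_pow] using congrArg (coeff · 2) hz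
  have hv := (mul_eq_zero.1 hv).resolve_left hchar
  have ht := (mul_eq_zero.1 ht).resolve_left hchar
  have ha0 : a ≠ 0 := fun h => ha 0 (by rw [h]; ring)
  have hpz : p * (a * r ^ 3 - q ^ 3) = 0 := by linear_combination r * hv - q * ht
  rcases mul_eq_zero.1 hpz with hp | hp
  · subst hp
    have : a * (q ^ 2 * r) = 0 := by linear_combination hv
    rcases mul_eq_zero.1 ((mul_eq_zero.1 this).resolve_left ha0) with h | h
    · have hq : q = 0 := by simpa using h
      exact ⟨r, Or.inr (Or.inr (by rw [hyx, hq]; simp))⟩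
    · exact ⟨q, Or.inr (Or.inl (by rw [hyx, h]; simp))⟩
  · have hr : r = 0 := by
      by_contra hr
      refine ha (q / r) ?_
      field_simp
      linear_combination -hp
    have hq : q = 0 := by
      rw [hr] at hp
      have : q ^ 3 = 0 := by linear_combination -hp
      simpa using this
    exact ⟨p, Or.inl (by rw [hyx, hr, hq]; simp)⟩

end aux

/-- Let `F` be a field of characteristic different from `3` containing no nontrivial cube
root of unity, and let `A` be a central simple `F`-algebra of dimension `9`. Then there is no
injective group homomorphism from `(ℤ/3ℤ)²` into `A^×/F^×`. -/
theorem stmt_0 (F A : Type*) [Field F] [Ring A] [Algebra F A]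
    (hchar : (3 : F) ≠ 0)
    (hcube : ∀ x : F, x ^ 3 = 1 → x = 1)
    [Algebra.IsCentral F A] [IsSimpleRing A]
    (hdim : Module.finrank F A = 9) :
    ¬ ∃ f : (Multiplicative (ZMod 3) × Multiplicative (ZMod 3)) →* (Aˣ ⧸ projUnits F A), Function.Injective f := by
  rintro ⟨f, hf⟩
  obtain ⟨x, hx⟩ := QuotientGroup.mk_surjective (f (Multiplicative.ofAdd 1, 1))
  obtain ⟨y, hy⟩ := QuotientGroup.mk_surjective (f (1, Multiplicative.ofAdd 1))
  have hmem : ∀ z : Aˣ, (z : Aˣ ⧸ projUnits F A) = 1 ↔ ∃ c : F, (z : A) = algebraMap F A c := by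
    have : Nontrivial A := Module.nontrivial_of_finrank_pos (R := F) (by omega)
    intro z
    rw [QuotientGroup.eq_one_iff]
    constructor
    · rintro ⟨c, rfl⟩
      exact ⟨c, rfl⟩
    · rintro ⟨c, hc⟩
      have hc0 : c ≠ 0 := by
        rintro rfl
        rw [map_zero] at hc
        exact z.ne_zero hc
      exact ⟨Units.mk0 c hc0, Units.ext hc.symm⟩
  have hgen : ∀ i j : ℕ, (∃ c : F, (x : A) ^ i * (y : A) ^ j = algebraMap F A c) ↔
      ((i : ZMod 3) = 0 ∧ (j : ZMod 3) = 0) := by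
    intro i j
    have h := hmem (x ^ i * y ^ j)
    push_cast at h
    rw [← h, QuotientGroup.mk_mul, QuotientGroup.mk_pow, QuotientGroup.mk_pow, hx, hy, ← map_pow,
      ← map_pow, ← map_mul, map_eq_one_iff f hf]
    simp [Prod.ext_iff, ← ofAdd_nsmul]
  obtain ⟨a, ha⟩ := (hgen 3 0).2 ⟨by decide, by decide⟩
  obtain ⟨b, hb⟩ := (hgen 0 3).2 ⟨by decide, by decide⟩
  rw [pow_zero, mul_one] at ha
  rw [pow_zero, one_mul] at hb
  have hxy : Commute (x : A) y := by
    have hc : ((x * y * x⁻¹ * y⁻¹ : Aˣ) : Aˣ ⧸ projUnits F A) = 1 := by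
      simp only [QuotientGroup.mk_mul, QuotientGroup.mk_inv, hx, hy, ← map_mul, ← map_inv]
      rw [map_eq_one_iff f hf]
      simp
    obtain ⟨c, hc⟩ := (hmem _).1 hc
    have h1 : (x : A) * y = algebraMap F A c * (y * x) := by
      rw [← hc]
      simp [mul_assoc]
    have h2 : ∀ n : ℕ, (x : A) * (y : A) ^ n = algebraMap F A (c ^ n) * (y ^ n * x) := by
      intro n
      induction n with
      | zero => simp
      | succ n ih =>
        rw [pow_succ, ← mul_assoc, ih, mul_assoc, mul_assoc, h1, ← mul_assoc (y ^ n : A),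
          ← Algebra.commutes, pow_succ c, map_mul]
        simp only [mul_assoc]
    have h3 := h2 3
    have hc3 : c ^ 3 = 1 := by
      have hinj : Function.Injective (algebraMap F A) := by
        have : Nontrivial A := Module.nontrivial_of_finrank_pos (R := F) (by omega)
        exact (algebraMap F A).injective
      rw [hb, Algebra.commutes b (x : A) |>.symm, ← hb] at h3
      apply hinj
      have h4 : ((y ^ 3 * x : Aˣ) : A) = algebraMap F A (c ^ 3) * ((y ^ 3 * x : Aˣ) : A) := by
        rw [Units.val_mul, Units.val_pow_eq_pow_val]
        exact h3
      rw [map_one]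
      exact (Units.mul_left_inj (y ^ 3 * x)).1 (by rw [one_mul]; exact h4.symm)
    rw [hcube c hc3, map_one, one_mul] at h1
    exact h1
  have hns : ∀ i j : ℕ, ¬ ((i : ZMod 3) = 0 ∧ (j : ZMod 3) = 0) → ∀ c : F,
      (x : A) ^ i * (y : A) ^ j ≠ algebraMap F A c := fun i j h c hc => h ((hgen i j).1 ⟨c, hc⟩)
  by_cases hac : ∀ c : F, c ^ 3 ≠ a
  · obtain ⟨s, h⟩ := aux_noncube hchar hcube hdim x y a b ha hb hxy hac
      (fun c => by simpa using hns 1 0 (by decide) c)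
    rcases h with h | h | h
    · exact hns 0 1 (by decide) s (by simpa using h)
    · refine hns 2 1 (by decide) (s * a) ?_
      rw [pow_one, h, ← mul_assoc, ← Algebra.commutes, mul_assoc, ← pow_succ, ha, map_mul]
    · refine hns 1 1 (by decide) (s * a) ?_
      rw [pow_one, pow_one, h, ← mul_assoc, ← Algebra.commutes, mul_assoc, ← pow_succ', ha, map_mul]
  by_cases hbc : ∀ c : F, c ^ 3 ≠ b
  · obtain ⟨s, h⟩ := aux_noncube hchar hcube hdim y x b a hb ha hxy.symm hbc
      (fun c => by simpa using hns 0 1 (by decide) c)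
    rcases h with h | h | h
    · exact hns 1 0 (by decide) s (by simpa using h)
    · refine hns 1 2 (by decide) (s * b) ?_
      rw [pow_one, h, mul_assoc, ← pow_succ', hb, map_mul]
    · refine hns 1 1 (by decide) (s * b) ?_
      rw [pow_one, pow_one, h, mul_assoc, ← pow_succ, hb, map_mul]
  push Not at hac hbc
  obtain ⟨c, rfl⟩ := hac
  obtain ⟨d, rfl⟩ := hbc
  have hNT : Nontrivial A := Module.nontrivial_of_finrank_pos (R := F) (by omega)
  have hc0 : c ≠ 0 := by
    rintro rfl
    apply (x ^ 3).ne_zero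
    push_cast
    rw [ha]; simp
  have hd0 : d ≠ 0 := by
    rintro rfl
    apply (y ^ 3).ne_zero
    push_cast
    rw [hb]; simp
  have hsc : ∀ (z : A) (s : F), s ≠ 0 → s • z = 1 → z = algebraMap F A s⁻¹ := by
    intro z s hs h
    rw [Algebra.algebraMap_eq_smul_one, ← h, smul_smul, inv_mul_cancel₀ hs, one_smul]
  have hci := inv_ne_zero hc0
  have hdi := inv_ne_zero hd0
  have hfin := aux_cube hchar hcube hdim (c⁻¹ • (x : A)) (d⁻¹ • (y : A))
    (by rw [smul_pow, ha, Algebra.algebraMap_eq_smul_one, smul_smul, ← mul_pow,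
          inv_mul_cancel₀ hc0, one_pow, one_smul])
    (by rw [smul_pow, hb, Algebra.algebraMap_eq_smul_one, smul_smul, ← mul_pow,
          inv_mul_cancel₀ hd0, one_pow, one_smul])
    ((hxy.smul_left _).smul_right _)
    (fun h => hns 1 0 (by decide) _ (by simpa using hsc _ _ hci h))
    (fun h => by
      rw [smul_mul_smul_comm] at h
      exact hns 1 1 (by decide) _ (by
        rw [pow_one, pow_one]
        exact hsc _ _ (mul_ne_zero hci hdi) h))
    (fun h => by
      rw [smul_pow, smul_mul_smul_comm] at h
      exact hns 1 2 (by decide) _ (by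
        rw [pow_one]
        exact hsc _ _ (mul_ne_zero hci (pow_ne_zero 2 hdi)) h))
  exact hns 0 1 (by decide) _ (by simpa using hsc _ _ hdi hfin)
end

section
/- Let F be a field of characteristic different from 3 and let A be a central simple F-algebra with dim_F A = 9. Then the quotient group A^×/F^× contains an element of order 3; equivalently, there exists α ∈ A^× such that α ∉ {c·1 : c ∈ F^×} but α³ ∈ {c·1 : c ∈ F^×}. -/
open Polynomial Module

lemma finrank_adjoin_eq_deg (F D : Type*) [Field F] [Ring D] [Algebra F D] [FiniteDimensional F D]
    (a : D) : finrank F (Algebra.adjoin F {a}) = (minpoly F a).natDegree := by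
  have hint : IsIntegral F a := Algebra.IsIntegral.isIntegral a
  have hm := minpoly.monic hint
  let φ := (aeval a : F[X] →ₐ[F] D).toLinearMap.domRestrict (degreeLT F (minpoly F a).natDegree)
  have hinj : Function.Injective φ := by
    rw [← LinearMap.ker_eq_bot, LinearMap.ker_eq_bot']
    rintro ⟨p, hp⟩ h
    have h' : aeval a p = 0 := h
    by_contra hne
    have hp0 : p ≠ 0 := fun h0 => hne (by ext1; exact h0)
    have := minpoly.degree_le_of_ne_zero F a hp0 h'
    rw [mem_degreeLT, ← degree_eq_natDegree hm.ne_zero] at hp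
    exact absurd hp (not_lt.mpr this)
  have hr : LinearMap.range φ = Subalgebra.toSubmodule (Algebra.adjoin F {a}) := by
    rw [Algebra.adjoin_singleton_eq_range_aeval]
    ext y
    constructor
    · rintro ⟨⟨p, hp⟩, rfl⟩
      exact ⟨p, rfl⟩
    · rintro ⟨p, rfl⟩
      refine ⟨⟨p %ₘ minpoly F a, ?_⟩, ?_⟩
      · rw [mem_degreeLT, ← degree_eq_natDegree hm.ne_zero]
        exact degree_modByMonic_lt _ hm
      · exact aeval_modByMonic_eq_self_of_root (minpoly.aeval F a)
  have h1 := LinearMap.finrank_range_of_inj hinj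
  rw [hr, Subalgebra.finrank_toSubmodule] at h1
  rw [h1, (degreeLTEquiv F _).finrank_eq]
  simp

section
variable {F D : Type*} [Field F] [DivisionRing D] [Algebra F D]

lemma sub_dim (hdim : finrank F D = 9) (B : Subalgebra F D) (hb : B ≠ ⊥) (ht : B ≠ ⊤) :
    finrank F B = 3 := by
  have : FiniteDimensional F D := .of_finrank_pos (by omega)
  let := divisionRingOfFiniteDimensional F B
  have h : finrank F B ∣ 9 := hdim ▸ ⟨_, (finrank_mul_finrank F B D).symm⟩
  have h2 : finrank F B ∈ Nat.divisors 9 := by simpa using h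
  have h3 : Nat.divisors 9 = {1, 3, 9} := by decide
  rw [h3] at h2
  simp only [Finset.mem_insert, Finset.mem_singleton] at h2
  rcases h2 with h2 | h2 | h2
  · exact absurd (Subalgebra.eq_bot_of_finrank_one h2) hb
  · exact h2
  · exact absurd (Algebra.toSubmodule_eq_top.1 
      (Submodule.eq_top_of_finrank_eq <| B.finrank_toSubmodule.trans (h2.trans hdim.symm))) ht

lemma bot_comm (y : D) (h : y ∈ (⊥ : Subalgebra F D)) (z : D) : y * z = z * y := by
  obtain ⟨c, rfl⟩ := Algebra.mem_bot.1 h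
  exact Algebra.commutes c z

variable [Algebra.IsCentral F D]

lemma mem_bot_of_comm (y : D) (h : ∀ z, y * z = z * y) : y ∈ (⊥ : Subalgebra F D) := by
  rw [← Algebra.IsCentral.center_eq_bot F D, Subalgebra.mem_center_iff]
  exact fun b => (h b).symm

lemma adjoin_dim (hdim : finrank F D = 9) (a : D) (ha : a ∉ (⊥ : Subalgebra F D)) :
    finrank F (Algebra.adjoin F {a}) = 3 := by
  have hmem : a ∈ Algebra.adjoin F {a} := Algebra.self_mem_adjoin_singleton F a
  apply sub_dim hdim
  · intro h; exact ha (h ▸ hmem)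
  · intro h
    apply ha
    apply mem_bot_of_comm
    intro z
    have hz : z ∈ Algebra.adjoin F {a} := h ▸ Algebra.mem_top
    exact Algebra.commute_of_mem_adjoin_singleton_of_commute hz rfl

lemma comm_of_comm (hdim : finrank F D = 9) (y u v : D) (hy : y ∉ (⊥ : Subalgebra F D))
    (hu : y * u = u * y) (hv : y * v = v * y) : u * v = v * u := by
  have : FiniteDimensional F D := .of_finrank_pos (by omega)
  by_cases hub : u ∈ (⊥ : Subalgebra F D)
  · exact bot_comm u hub v
  have hC : finrank F (Subalgebra.centralizer F {y}) = 3 := by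
    apply sub_dim hdim
    · intro h
      apply hy
      rw [← h, Subalgebra.mem_centralizer_iff]
      simp
    · intro h
      apply hy
      apply mem_bot_of_comm
      intro z
      have hz : z ∈ Subalgebra.centralizer F {y} := h ▸ Algebra.mem_top
      exact Subalgebra.mem_centralizer_iff F |>.1 hz y rfl
  have hle : Algebra.adjoin F {u} ≤ Subalgebra.centralizer F {y} := by
    rw [Algebra.adjoin_le_iff]
    intro x hx
    rw [Set.mem_singleton_iff] at hx
    rw [hx, SetLike.mem_coe, Subalgebra.mem_centralizer_iff]
    simpa using hu
  have heq : Algebra.adjoin F {u} = Subalgebra.centralizer F {y} := by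
    apply Subalgebra.toSubmodule_injective
    apply Submodule.eq_of_le_of_finrank_eq hle
    rw [Subalgebra.finrank_toSubmodule, Subalgebra.finrank_toSubmodule, hC, adjoin_dim hdim u hub]
  have hvm : v ∈ Algebra.adjoin F {u} := by
    rw [heq]; simpa [Subalgebra.mem_centralizer_iff] using hv
  exact Algebra.commute_of_mem_adjoin_singleton_of_commute hvm rfl

lemma cubic (hdim : finrank F D = 9) (a : D) (ha : a ∉ (⊥ : Subalgebra F D)) :
    ∃ e1 e2 e3 : F, a^3 - algebraMap F D e1 * a^2 + algebraMap F D e2 * a - algebraMap F D e3 = 0 := by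
  have : FiniteDimensional F D := .of_finrank_pos (by omega)
  have h := finrank_adjoin_eq_deg F D a
  rw [adjoin_dim hdim a ha] at h
  have hm := minpoly.monic (Algebra.IsIntegral.isIntegral (R := F) a)
  have h0 := minpoly.aeval F a
  refine ⟨-(minpoly F a).coeff 2, (minpoly F a).coeff 1, -(minpoly F a).coeff 0, ?_⟩
  have h3 : (minpoly F a).coeff 3 = 1 := by rw [h]; exact hm
  rw [aeval_eq_sum_range, ← h] at h0
  simp only [Finset.sum_range_succ, Finset.sum_range_zero, h3, Algebra.smul_def] at h0
  simp only [map_neg, map_one] at *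
  rw [← h0]; noncomm_ring

lemma noquad (hdim : finrank F D = 9) (a : D) (ha : a ∉ (⊥ : Subalgebra F D)) (p q r : F)
   (hp : p ≠ 0) :
    algebraMap F D p * a^2 + algebraMap F D q * a + algebraMap F D r ≠ 0 := by
  have : FiniteDimensional F D := .of_finrank_pos (by omega)
  have h := finrank_adjoin_eq_deg F D a
  rw [adjoin_dim hdim a ha] at h
  intro h0
  have hd : (C p * X^2 + C q * X + C r).natDegree = 2 := natDegree_quadratic hp
  have hne : (C p * X^2 + C q * X + C r) ≠ 0 := by
    intro h1; rw [h1] at hd; simp at hd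
  have := natDegree_le_natDegree (minpoly.degree_le_of_ne_zero F a hne (by simpa using h0))
  omega
end

/- Pure algebra part -/
lemma wed_alg {D : Type*} [Ring D] (a b e1 e2 e3 : D)
    (c1 : ∀ z, e1 * z = z * e1) (c2 : ∀ z, e2 * z = z * e2)
    (ha : a^3 - e1*a^2+e2*a-e3=0) (hb : b^3 - e1*b^2+e2*b-e3=0)
    (hg : b^2 + a*b+a^2-e1*b-e1*a+e2=0) :
    (a*b-b*a)*a = b*(a*b-b*a) := by
  have h1 : (b^2 + a*b+a^2-e1*b-e1*a+e2)*a = 0 := by rw [hg, zero_mul]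
  have h2 : b*(b^2 + a*b+a^2-e1*b-e1*a+e2) = 0 := by rw [hg, mul_zero]
  have h3 : (a*b-b*a)*a - b*(a*b-b*a) = (b^2 + a*b+a^2-e1*b-e1*a+e2)*a
     - b*(b^2 + a*b+a^2-e1*b-e1*a+e2) - (a^3 - e1*a^2+e2*a-e3) + (b^3 - e1*b^2+e2*b-e3)
     + (e1*b-b*e1)*b + (e1*b-b*e1)*a - (e2*b - b*e2) := by noncomm_ring
  rw [h1, h2, ha, hb, c1 b, c2 b] at h3
  exact sub_eq_zero.1 (by simpa using h3)

lemma wed_g {D : Type*} [Ring D] (a b e1 e2 : D)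
    (c1 : ∀ z, e1 * z = z * e1)
    (hg : b^2 + a*b+a^2-e1*b-e1*a+e2=0) :
    (e1-a-b)^2 + b*(e1-a-b)+b^2-e1*(e1-a-b)-e1*b+e2=0 := by
  have h : (e1-a-b)^2 + b*(e1-a-b)+b^2-e1*(e1-a-b)-e1*b+e2 =
     (b^2 + a*b+a^2-e1*b-e1*a+e2) + (e1*a-a*e1) := by noncomm_ring
  rw [h, hg, c1 a]; simp

lemma wed_f {D : Type*} [Ring D] (a b e1 e2 e3 : D)
    (c1 : ∀ z, e1 * z = z * e1) (c2 : ∀ z, e2 * z = z * e2)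
    (ha : a^3 - e1*a^2+e2*a-e3=0)
    (hg : b^2 + a*b+a^2-e1*b-e1*a+e2=0) :
    (e1-a-b)^3 - e1*(e1-a-b)^2+e2*(e1-a-b)-e3=0 := by
  have h1 : (e1-a-b)^2 - e1*(e1-a-b)+e2 = b*a := by
    have h : (e1-a-b)^2 - e1*(e1-a-b)+e2 = b*a + (b^2 + a*b+a^2-e1*b-e1*a+e2)
      + (e1*a-a*e1) + (e1*b-b*e1) := by noncomm_ring
    rw [h, hg, c1 a, c1 b]; simp
  have h2 : (e1-a-b)*b = a^2 - e1*a+e2 := by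
    have h : (e1-a-b)*b = a^2 - e1*a+e2 - (b^2 + a*b+a^2-e1*b-e1*a+e2) := by noncomm_ring
    rw [h, hg]; simp
  have h3 : (e1-a-b)^3 - e1*(e1-a-b)^2+e2*(e1-a-b)-e3 =
      (e1-a-b)*((e1-a-b)^2 - e1*(e1-a-b)+e2) - e3
      - (e1*(e1-a-b)-(e1-a-b)*e1)*(e1-a-b) + (e2*(e1-a-b)-(e1-a-b)*e2) := by noncomm_ring
  rw [h3, h1, c1 (e1-a-b), c2 (e1-a-b), ← mul_assoc, h2, ← ha]
  noncomm_ring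

lemma conj_f {D : Type*} [DivisionRing D] (a b z e1 e2 e3 : D)
    (c1 : ∀ z, e1 * z = z * e1) (c2 : ∀ z, e2 * z = z * e2) (c3 : ∀ z, e3 * z = z * e3)
    (ha : a^3 - e1*a^2+e2*a-e3=0) (hz : z ≠ 0) (hzab : z * a = b * z) :
    b^3 - e1*b^2+e2*b-e3=0 := by
  have h2 : b^2*z = z*a^2 := by rw [pow_two, mul_assoc, ← hzab, ← mul_assoc, ← hzab, mul_assoc, pow_two]
  have h3 : b^3*z = z*a^3 := by
    rw [pow_succ', mul_assoc, h2, ← mul_assoc, ← hzab, mul_assoc, ← pow_succ']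
  have h : (b^3 - e1*b^2+e2*b-e3)*z = z*(a^3 - e1*a^2+e2*a-e3) := by
    simp only [sub_mul, add_mul, mul_sub, mul_add, mul_assoc, h2, h3, ← hzab]
    rw [← mul_assoc e1, c1 z, ← mul_assoc e2, c2 z, c3 z]
    simp only [mul_assoc]
  rw [ha, mul_zero] at h
  exact (mul_eq_zero.1 h).resolve_right hz

lemma root_g {D : Type*} [DivisionRing D] (a b c e1 e2 e3 : D)
    (ha : a^3 - e1*a^2+e2*a-e3=0) (hb : b^3 - e1*b^2+e2*b-e3=0) (hab : b - a ≠ 0)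
    (hc : (b-a)*b = c*(b-a)) :
    c^2 + a*c+a^2-e1*c-e1*a+e2=0 := by
  have h2 : (b-a)*b^2 = c^2*(b-a) := by
    rw [pow_two, ← mul_assoc, hc, mul_assoc, hc, ← mul_assoc, pow_two]
  have h : (c^2 + a*c+a^2-e1*c-e1*a+e2)*(b-a) = 
      (c^2*(b-a) - (b-a)*b^2) + a * (c*(b-a) - (b-a)*b) - e1*(c*(b-a) - (b-a)*b)
      + (b^3 - e1*b^2+e2*b-e3) - (a^3 - e1*a^2+e2*a-e3) := by noncomm_ring
  rw [h2, hc, ha, hb] at h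
  simp only [sub_self, mul_zero, add_zero, mul_eq_zero] at h
  exact h.resolve_right hab

lemma div_case {F D : Type*} [Field F] [DivisionRing D] [Algebra F D] [Algebra.IsCentral F D]
    (hchar : (3 : F) ≠ 0) (hdim : finrank F D = 9) :
    ∃ w : D, w ∉ (⊥ : Subalgebra F D) ∧ w^3 ∈ (⊥ : Subalgebra F D) := by
  have hnt : (⊥ : Subalgebra F D) ≠ ⊤ := by
    intro h
    have := Subalgebra.bot_eq_top_iff_finrank_eq_one.1 h
    omega
  obtain ⟨a, ha⟩ : ∃ a : D, a ∉ (⊥ : Subalgebra F D) := by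
    by_contra! h
    exact hnt (Algebra.eq_top_iff.2 h)
  obtain ⟨d, hd⟩ : ∃ d : D, a * d ≠ d * a := by
    by_contra! h
    exact ha (mem_bot_of_comm a h)
  have hd0 : d ≠ 0 := by rintro rfl; simp at hd
  obtain ⟨f1, f2, f3, hfa⟩ := cubic hdim a ha
  have c1 := Algebra.commutes (R := F) (A := D) f1
  have c2 := Algebra.commutes (R := F) (A := D) f2
  have c3 := Algebra.commutes (R := F) (A := D) f3
  have hquad := noquad hdim a ha 3 (-2*f1) f2 hchar
  simp only [map_mul, map_neg, map_ofNat] at hquad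
  generalize algebraMap F D f1 = e1 at *
  generalize algebraMap F D f2 = e2 at *
  generalize algebraMap F D f3 = e3 at *
  -- the first conjugate
  obtain ⟨b, hb⟩ : ∃ b, d * a = b * d := ⟨d * a * d⁻¹, (inv_mul_cancel_right₀ hd0 _).symm⟩
  have hba : b - a ≠ 0 := by
    intro h
    rw [sub_eq_zero.1 h] at hb
    exact hd hb.symm
  have hfb := conj_f a b d e1 e2 e3 c1 c2 c3 hfa hd0 hb
  obtain ⟨c, hc⟩ : ∃ c, (b-a) * b = c * (b-a) := ⟨(b-a) * b * (b-a)⁻¹, (inv_mul_cancel_right₀ hba _).symm⟩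
  have hg := root_g a b c e1 e2 e3 hfa hfb hba hc
  obtain ⟨z, hz0, hz⟩ : ∃ z : D, z ≠ 0 ∧ z * a = c * z :=
    ⟨(b-a)*d, mul_ne_zero hba hd0, by rw [mul_assoc, hb, ← mul_assoc, hc, mul_assoc]⟩
  clear hc hba hfb hb hd hd0
  have hfc := conj_f a c z e1 e2 e3 c1 c2 c3 hfa hz0 hz
  have hac : a ≠ c := by
    rintro rfl
    apply hquad
    rw [← hg]; noncomm_ring
  have hcb : c ∉ (⊥ : Subalgebra F D) := by
    intro h
    have := bot_comm c h z
    rw [this] at hz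
    exact hac (mul_left_cancel₀ hz0 hz)
  -- reduction: it is enough to rotate `a → c → e1 - a - c`
  suffices h : ∃ w : D, w ≠ 0 ∧ w * a = c * w ∧ w * c = (e1 - a - c) * w by
    obtain ⟨w, hw0, hw1, hw2⟩ := h
    have hw3 : w * (e1 - a - c) = a * w := by
      rw [mul_sub, mul_sub, hw1, hw2, ← c1 w]; noncomm_ring
    have hnc : w * a ≠ a * w := by
      rw [hw1]; intro h
      exact hac (mul_right_cancel₀ hw0 h).symm
    refine ⟨w, fun h => hnc (bot_comm w h a), ?_⟩
    by_contra h
    refine hnc (comm_of_comm hdim (w^3) w a h (by noncomm_ring) ?_)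
    calc w^3*a = w*(w*(w*a)) := by noncomm_ring
      _ = w*(w*c)*w := by rw [hw1]; noncomm_ring
      _ = w * (e1-a-c) * w^2 := by rw [hw2]; noncomm_ring
      _ = a*w^3 := by rw [hw3]; noncomm_ring
  by_cases hcomm : a * c = c * a
  · refine ⟨z, hz0, hz, ?_⟩
    obtain ⟨t, ht⟩ : ∃ t, z * c = t * z := ⟨z * c * z⁻¹, (inv_mul_cancel_right₀ hz0 _).symm⟩
    have hft := conj_f c t z e1 e2 e3 c1 c2 c3 hfc hz0 ht
    have hct : c * t = t * c := by
      apply mul_right_cancel₀ hz0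
      rw [mul_assoc, mul_assoc, ← ht, ← hz, ← mul_assoc, ← hz, ← mul_assoc, ← ht, mul_assoc,
        mul_assoc, hcomm]
    have hat : a * t = t * a := comm_of_comm hdim c a t hcb hcomm.symm hct
    have hprod : (t - (e1 - a - c)) * ((t - c) * (t - a)) = 0 := by
      have h : (t - (e1 - a - c)) * ((t - c) * (t - a)) =
        (t^3 - e1*t^2+e2*t-e3) - (a^3 - e1*a^2+e2*a-e3) 
        - (c^2 + a*c+a^2-e1*c-e1*a+e2) * (t - a)
        + t*(a*t-t*a) + a*(a*t-t*a) + (a*t-t*a)*a - e1*(a*t-t*a)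
        + ((c*t-t*c) + (a*t-t*a))*(t-a) := by
        noncomm_ring
      rw [h, hft, hfa, hg, hat, hct]; simp
    rcases mul_eq_zero.1 hprod with h | h
    · rw [ht, sub_eq_zero.1 h]
    rcases mul_eq_zero.1 h with h | h
    · exfalso
      rw [sub_eq_zero.1 h, ← hz] at ht
      exact hac (mul_left_cancel₀ hz0 ht).symm
    · exfalso
      rw [sub_eq_zero.1 h] at ht
      have hnc : z * a ≠ a * z := by
        rw [hz]; intro h
        exact hac (mul_right_cancel₀ hz0 h).symm
      have hzb : z ∉ (⊥ : Subalgebra F D) := fun h => hnc (bot_comm z h a)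
      by_cases hz2 : z^2 ∈ (⊥ : Subalgebra F D)
      · obtain ⟨r, hr⟩ := Algebra.mem_bot.1 hz2
        apply noquad hdim z hzb 1 0 (-r) one_ne_zero
        simp [hr]
      · refine hnc (comm_of_comm hdim (z^2) z a hz2 (by noncomm_ring) ?_)
        rw [pow_two, mul_assoc, hz, ← mul_assoc, ht, mul_assoc]
  · refine ⟨a*c-c*a, sub_ne_zero.2 hcomm, wed_alg a c e1 e2 e3 c1 c2 hfa hfc hg, ?_⟩
    have hk := wed_alg c (e1-a-c) e1 e2 e3 c1 c2 hfc (wed_f a c e1 e2 e3 c1 c2 hfa hg)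
      (wed_g a c e1 e2 c1 hg)
    have hx : c*(e1-a-c) - (e1-a-c)*c = a*c-c*a := by
      have : c*(e1-a-c) - (e1-a-c)*c = a*c-c*a - (e1*c-c*e1) := by noncomm_ring
      rw [this, c1 c]; simp
    rwa [hx] at hk

lemma exists_elem (F A : Type*) [Field F] [Ring A] [Algebra F A]
    (hchar : (3 : F) ≠ 0)
    [Algebra.IsCentral F A] [IsSimpleRing A]
    (hdim : Module.finrank F A = 9) :
    ∃ w : A, IsUnit w ∧ w ∉ (⊥ : Subalgebra F A) ∧ w^3 ∈ (⊥ : Subalgebra F A) := by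
  have : FiniteDimensional F A := .of_finrank_pos (by omega)
  have : IsArtinianRing A := .of_finite F A
  obtain ⟨n, hn, D, _, _, _, ⟨e⟩⟩ := IsSimpleRing.exists_algEquiv_matrix_divisionRing_finite F A
  suffices h : ∃ w : Matrix (Fin n) (Fin n) D, IsUnit w ∧ w ∉ (⊥ : Subalgebra F _)
      ∧ w^3 ∈ (⊥ : Subalgebra F (Matrix (Fin n) (Fin n) D)) by
    obtain ⟨w, h1, h2, h3⟩ := h
    refine ⟨e.symm w, h1.map e.symm, fun h => h2 ?_, ?_⟩
    · obtain ⟨r, hr⟩ := Algebra.mem_bot.1 h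
      refine Algebra.mem_bot.2 ⟨r, ?_⟩
      rw [← e.commutes, hr]; simp
    · obtain ⟨r, hr⟩ := Algebra.mem_bot.1 h3
      refine Algebra.mem_bot.2 ⟨r, ?_⟩
      rw [← map_pow, ← hr, e.symm.commutes]
  have hd := e.toLinearEquiv.finrank_eq
  rw [hdim, Module.finrank_matrix] at hd
  simp only [Fintype.card_fin] at hd
  have hn3 : n ≤ 3 := by
    by_contra! h
    have : 0 < finrank F D := finrank_pos
    nlinarith
  have hn0 := NeZero.ne n
  interval_cases n
  · exact absurd rfl hn0
  · obtain ⟨e1⟩ : Nonempty (Matrix (Fin 1) (Fin 1) D ≃ₐ[F] D) := by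
      convert! Nonempty.intro (Matrix.uniqueAlgEquiv (m := Fin 1) (R := F) (A := D))
    have : Algebra.IsCentral F D := Algebra.IsCentral.of_algEquiv F A D (e.trans e1)
    obtain ⟨w, h2, h3⟩ := div_case (F := F) (D := D) hchar (by omega)
    have hw : w ≠ 0 := by rintro rfl; exact h2 (zero_mem _)
    refine ⟨e1.symm w, hw.isUnit.map e1.symm, fun h => h2 ?_, ?_⟩
    · obtain ⟨r, hr⟩ := Algebra.mem_bot.1 h
      refine Algebra.mem_bot.2 ⟨r, ?_⟩
      rw [← e1.commutes, hr]; simp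
    · obtain ⟨r, hr⟩ := Algebra.mem_bot.1 h3
      refine Algebra.mem_bot.2 ⟨r, ?_⟩
      rw [← map_pow, ← hr, e1.symm.commutes]
  · omega
  · have h3 : (!![0,1,0;0,0,1;1,0,0] : Matrix (Fin 3) (Fin 3) D)^3 = 1 := by
      ext i j
      fin_cases i <;> fin_cases j <;> simp [pow_succ, Matrix.mul_apply, Fin.sum_univ_succ]
    refine ⟨!![0,1,0;0,0,1;1,0,0], IsUnit.of_pow_eq_one h3 (by norm_num), ?_, ?_⟩
    · intro h
      obtain ⟨r, hr⟩ := Algebra.mem_bot.1 h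
      have := congrFun (congrFun hr 0) 1
      simp [Matrix.algebraMap_matrix_apply] at this
    · rw [h3]; exact one_mem _

/-- Let `F` be a field of characteristic different from `3` and `A` a central simple
`F`-algebra of dimension `9`. Then `A^×/F^×` contains an element of order `3`; equivalently,
there is `α ∈ A^×` which is not a scalar but whose cube is a scalar. -/
theorem stmt_2 (F A : Type*) [Field F] [Ring A] [Algebra F A]
    (hchar : (3 : F) ≠ 0)
    [Algebra.IsCentral F A] [IsSimpleRing A]
    (hdim : Module.finrank F A = 9) :
    (∃ g : Aˣ ⧸ projUnits F A, orderOf g = 3) ∧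
      ∃ α : Aˣ, α ∉ projUnits F A ∧ α ^ 3 ∈ projUnits F A := by
  have key : ∃ α : Aˣ, α ∉ projUnits F A ∧ α ^ 3 ∈ projUnits F A := by
    obtain ⟨w, ⟨u, rfl⟩, h2, h3⟩ := exists_elem F A hchar hdim
    refine ⟨u, ?_, ?_⟩
    · rintro ⟨c, rfl⟩
      exact h2 (Algebra.mem_bot.2 ⟨c, rfl⟩)
    · obtain ⟨r, hr⟩ := Algebra.mem_bot.1 h3
      have : Nontrivial A := ⟨⟨_, _, fun h : (u : A) = 0 => h2 (h ▸ zero_mem _)⟩⟩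
      have hr0 : r ≠ 0 := by
        rintro rfl
        rw [map_zero] at hr
        exact (u^3).ne_zero (by rw [Units.val_pow_eq_pow_val, ← hr])
      exact ⟨Units.mk0 r hr0, by ext; simpa using hr⟩
  refine ⟨?_, key⟩
  obtain ⟨α, h1, h2⟩ := key
  have : Fact (Nat.Prime 3) := ⟨Nat.prime_three⟩
  refine ⟨(α : Aˣ ⧸ projUnits F A), orderOf_eq_prime ?_ ?_⟩
  · rw [← QuotientGroup.mk_pow]
    exact (QuotientGroup.eq_one_iff _).2 h2
  · exact fun h => h1 ((QuotientGroup.eq_one_iff _).1 h)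
end

section
/- Let F be a field of characteristic different from 3 that contains a nontrivial cube root of unity ω (ω³ = 1, ω ≠ 1), and let A be a central simple F-algebra with dim_F A = 9. Then there exists an injective group homomorphism from (ℤ/3ℤ)² into the quotient group A^×/F^×; moreover one can find α, β ∈ A^× with α³ and β³ central scalars, α and β not scalars, and α·β = ω·(β·α), whose images generate this subgroup. -/
open Module in
lemma aux_trace_lsmul (F K V : Type*) [Field F] [Field K] [Algebra F K] [AddCommGroup V]
    [Module F V] [Module K V] [IsScalarTower F K V] [FiniteDimensional F K]
    [FiniteDimensional K V] (x : K) :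
    LinearMap.trace F V (Algebra.lsmul F F V x) = finrank K V • Algebra.trace F K x := by
  classical
  let b := Module.finBasis F K
  let c := Module.finBasis K V
  rw [LinearMap.trace_eq_matrix_trace F (b.smulTower c), Algebra.trace_eq_matrix_trace b,
    Matrix.trace, Matrix.trace, ← Finset.univ_product_univ, Finset.sum_product, Finset.sum_comm]
  have : ∀ (j : Fin (finrank K V)), ∑ i, (LinearMap.toMatrix (b.smulTower c) (b.smulTower c)
      (Algebra.lsmul F F V x)).diag (i, j) = ∑ i, ((Algebra.leftMulMatrix b) x).diag i := by
    intro j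
    refine Finset.sum_congr rfl fun i _ => ?_
    simp only [Matrix.diag, LinearMap.toMatrix_apply, Algebra.leftMulMatrix_eq_repr_mul,
      Basis.smulTower_apply, Algebra.lsmul_coe, Basis.smulTower_repr, smul_smul]
    simp
  rw [Finset.sum_congr rfl fun j _ => this j]
  simp

/-- The trace of left multiplication. -/
noncomputable def auxT (F D : Type*) [Field F] [Ring D] [Algebra F D] : D →ₗ[F] F :=
  (LinearMap.trace F D) ∘ₗ (Algebra.lmul F D).toLinearMap

section div
variable {F D : Type*} [Field F] [DivisionRing D] [Algebra F D]

open Module Polynomial in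
lemma aux_deg (hd : finrank F D = 9) (hc : Subalgebra.center F D = ⊥) (x : D)
    (hx : x ∉ (⊥ : Subalgebra F D)) :
    (minpoly F x).natDegree = 3 ∧
      (auxT F D x = 3 * -(minpoly F x).nextCoeff) := by
  have hfin : FiniteDimensional F D := FiniteDimensional.of_finrank_pos (by omega)
  have hint : IsIntegral F x := Algebra.IsIntegral.isIntegral x
  have hirr : Irreducible (minpoly F x) := minpoly.irreducible hint
  have : Fact (Irreducible (minpoly F x)) := ⟨hirr⟩
  let p := minpoly F x
  let K := AdjoinRoot p
  let φ : K →ₐ[F] D := Ideal.Quotient.liftₐ (Ideal.span {p}) (Polynomial.aeval x) (by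
    intro a ha
    obtain ⟨q, rfl⟩ := Ideal.mem_span_singleton.1 ha
    rw [map_mul, minpoly.aeval, zero_mul])
  have hφx : φ (AdjoinRoot.root p) = x := by
    change Polynomial.aeval x X = x
    simp
  let : Module K D := Module.compHom D (φ : K →+* D)
  have hsm : ∀ (k : K) (d : D), k • d = φ k * d := fun _ _ => rfl
  have : IsScalarTower F K D := ⟨fun a k d => by
    rw [hsm, hsm, map_smul, smul_mul_assoc]⟩
  have : FiniteDimensional F K := (AdjoinRoot.powerBasis hirr.ne_zero).finite
  have : FiniteDimensional K D := FiniteDimensional.right F K D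
  have hK : finrank F K = p.natDegree := by
    rw [(AdjoinRoot.powerBasis hirr.ne_zero).finrank]; rfl
  have hmul := finrank_mul_finrank F K D
  rw [hd, hK] at hmul
  have h1 : p.natDegree ≠ 1 := by
    intro h
    have := (minpoly.natDegree_eq_one_iff (A := F) (x := x)).1 h
    exact hx this
  have h9 : p.natDegree ≠ 9 := by
    intro h
    have hinj : Function.Injective φ.toLinearMap := φ.toRingHom.injective
    have hsurj : Function.Surjective φ.toLinearMap :=
      (LinearMap.injective_iff_surjective_of_finrank_eq_finrank (by rw [hK, hd, h])).1 hinj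
    apply hx
    rw [← hc, Subalgebra.mem_center_iff]
    intro b
    obtain ⟨k, rfl⟩ := hsurj b
    change φ k * x = x * φ k
    rw [← hφx, ← map_mul, ← map_mul, mul_comm]
  have h3 : p.natDegree = 3 := by
    have hdvd : p.natDegree ∣ 3 ^ 2 := ⟨_, hmul.symm⟩
    obtain ⟨k, hk, hk'⟩ := (Nat.dvd_prime_pow Nat.prime_three).1 hdvd
    interval_cases k <;> simp_all
  refine ⟨h3, ?_⟩
  have h3' : finrank K D = 3 := by rw [h3] at hmul; omega
  have ht := aux_trace_lsmul F K D (AdjoinRoot.root p)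
  have hpb := (AdjoinRoot.powerBasis hirr.ne_zero).trace_gen_eq_nextCoeff_minpoly
  rw [AdjoinRoot.powerBasis_gen, AdjoinRoot.minpoly_root hirr.ne_zero] at hpb
  rw [h3', hpb] at ht
  have hmon : p.leadingCoeff = 1 := minpoly.monic hint
  have e : (Algebra.lsmul F F D (AdjoinRoot.root p) : D →ₗ[F] D) = Algebra.lmul F D x := by
    ext d
    change AdjoinRoot.root p • d = x * d
    rw [hsm, hφx]
  change LinearMap.trace F D (Algebra.lmul F D x) = _
  rw [← e, ht]
  change 3 • -(p * C (p.leadingCoeff)⁻¹).nextCoeff = 3 * -p.nextCoeff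
  rw [hmon]; simp


lemma auxT_comm (x y : D) : auxT F D (x * y) = auxT F D (y * x) := by
  change LinearMap.trace F D (Algebra.lmul F D (x * y)) =
    LinearMap.trace F D (Algebra.lmul F D (y * x))
  rw [map_mul (Algebra.lmul F D), map_mul (Algebra.lmul F D), LinearMap.trace_mul_comm]

lemma auxT_one (hd : Module.finrank F D = 9) : auxT F D 1 = 9 := by
  change LinearMap.trace F D (Algebra.lmul F D 1) = 9
  have hfin : FiniteDimensional F D := FiniteDimensional.of_finrank_pos (by omega)
  rw [map_one, LinearMap.trace_one, hd]; norm_num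

open Polynomial in
/-- A non-scalar element of reduced trace zero satisfies a depressed cubic. -/
lemma aux_cubic (h3 : (3 : F) ≠ 0) (hd : Module.finrank F D = 9)
    (hc : Subalgebra.center F D = ⊥) (x : D)
    (hx : x ∉ (⊥ : Subalgebra F D)) (ht : auxT F D x = 0) :
    ∃ b c : F, x ^ 3 + b • x + algebraMap F D c = 0 := by
  obtain ⟨h, h'⟩ := aux_deg hd hc x hx
  have hfin : FiniteDimensional F D := FiniteDimensional.of_finrank_pos (by omega)
  have hm : (minpoly F x).Monic := minpoly.monic (Algebra.IsIntegral.isIntegral x)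
  rw [ht] at h'
  have h0 : (minpoly F x).nextCoeff = 0 := by
    have := h'.symm
    simpa [h3] using this
  rw [nextCoeff_of_natDegree_pos (by omega), h] at h0
  have hl := hm.coeff_natDegree
  rw [h] at hl
  have he := minpoly.aeval F x
  rw [aeval_eq_sum_range, h] at he
  simp only [Finset.sum_range_succ, Finset.sum_range_zero] at he
  refine ⟨(minpoly F x).coeff 1, (minpoly F x).coeff 0, ?_⟩
  simp only [Nat.add_one_sub_one] at h0
  rw [hl, h0] at he
  rw [← he, Algebra.algebraMap_eq_smul_one]
  simp
  abel

open Polynomial in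
lemma aux_quad (hd : Module.finrank F D = 9)
    (hc : Subalgebra.center F D = ⊥) (x : D)
    (hx : x ∉ (⊥ : Subalgebra F D)) (a b c : F)
    (h : a • x ^ 2 + b • x + algebraMap F D c = 0) : a = 0 := by
  obtain ⟨h3, -⟩ := aux_deg hd hc x hx
  by_contra ha
  have hdeg : (C a * X ^ 2 + C b * X + C c).natDegree = 2 := natDegree_quadratic ha
  have hne : (C a * X ^ 2 + C b * X + C c) ≠ 0 := by
    intro h0; rw [h0] at hdeg; simp at hdeg
  have := natDegree_le_natDegree (minpoly.degree_le_of_ne_zero F x hne (by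
    simpa [Algebra.smul_def] using h))
  omega

lemma aux_cube_s3 (h3 : (3 : F) ≠ 0) (hd : Module.finrank F D = 9)
    (hc : Subalgebra.center F D = ⊥) (x : D)
    (hx : x ∉ (⊥ : Subalgebra F D)) (ht : auxT F D x = 0) (ht' : auxT F D x⁻¹ = 0) :
    ∃ c : F, c ≠ 0 ∧ x ^ 3 = algebraMap F D c := by
  have hx0 : x ≠ 0 := fun h => hx (h ▸ zero_mem _)
  have hy : x⁻¹ ∉ (⊥ : Subalgebra F D) := by
    intro h
    obtain ⟨c, hc⟩ := Algebra.mem_bot.1 h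
    apply hx
    rw [← inv_inv x, ← hc, ← map_inv₀]
    exact Algebra.mem_bot.2 ⟨_, rfl⟩
  obtain ⟨s, n, hp⟩ := aux_cubic h3 hd hc x hx ht
  obtain ⟨b, c, hq⟩ := aux_cubic h3 hd hc x⁻¹ hy ht'
  have hq' : 1 + b • x ^ 2 + c • x ^ 3 = 0 := by
    have := congrArg (· * x ^ 3) hq
    simp only [add_mul, zero_mul, smul_mul_assoc, inv_pow] at this
    rw [inv_mul_cancel₀ (pow_ne_zero 3 hx0), ← Algebra.smul_def] at this
    rwa [pow_succ' x 2, inv_mul_cancel_left₀ hx0, ← pow_succ' x 2] at this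
  have hb : b = 0 := by
    apply aux_quad hd hc x hx b (- c * s) (1 - c * n)
    have e : x ^ 3 = - (s • x) - n • 1 := by
      rw [Algebra.algebraMap_eq_smul_one] at hp
      rw [eq_sub_iff_add_eq, eq_neg_iff_add_eq_zero, ← hp]; abel
    rw [e] at hq'
    rw [← hq', Algebra.algebraMap_eq_smul_one]
    module
  rw [hb, zero_smul, add_zero] at hq'
  have hc0 : c ≠ 0 := by
    rintro rfl; simp at hq'
  refine ⟨-c⁻¹, by simpa using hc0, ?_⟩
  rw [Algebra.algebraMap_eq_smul_one]
  have : (1 : D) = - (c • x ^ 3) := eq_neg_of_add_eq_zero_left hq'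
  rw [this, smul_neg, neg_smul, neg_neg, smul_smul, inv_mul_cancel₀ hc0, one_smul]

lemma aux_exists_alpha (h3 : (3 : F) ≠ 0) (hd : Module.finrank F D = 9)
    (hc : Subalgebra.center F D = ⊥) :
    ∃ x : D, x ∉ (⊥ : Subalgebra F D) ∧ ∃ c : F, c ≠ 0 ∧ x ^ 3 = algebraMap F D c := by
  have hfin : FiniteDimensional F D := FiniteDimensional.of_finrank_pos (by omega)
  obtain ⟨y, hy⟩ : ∃ y : D, y ∉ (⊥ : Subalgebra F D) := by
    by_contra! h
    have : (⊥ : Subalgebra F D) = ⊤ := by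
      rw [eq_top_iff]; intro y _; exact h y
    have h1 := Subalgebra.bot_eq_top_iff_finrank_eq_one.1 this
    omega
  let K := Algebra.adjoin F {y}
  have hyK : y ∈ K := Algebra.self_mem_adjoin_singleton F y
  have hK9 : Module.finrank F K < Module.finrank F D := by
    change Module.finrank F (Subalgebra.toSubmodule K) < _
    apply Submodule.finrank_lt
    rw [Ne, Algebra.toSubmodule_eq_top]
    intro htop
    apply hy
    rw [← hc, Subalgebra.mem_center_iff]
    intro b
    have hb : b ∈ K := htop ▸ Algebra.mem_top
    have := Algebra.adjoin_le_centralizer_centralizer F {y} hb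
    rw [Subalgebra.mem_centralizer_iff] at this
    exact (this y (by
      rw [SetLike.mem_coe, Subalgebra.mem_centralizer_iff]; simp)).symm
  have hK1 : Module.finrank F F < Module.finrank F K := by
    rw [Module.finrank_self]
    by_contra! h
    have hpos : 0 < Module.finrank F K := Module.finrank_pos
    have : K = ⊥ := Subalgebra.eq_bot_of_finrank_one (by omega)
    exact hy (this ▸ hyK)
  -- the orthogonal complement
  let Φ : D →ₗ[F] (K →ₗ[F] F) :=
    LinearMap.mk₂ F (fun a k => auxT F D ((k : D) * a))
      (by intros; simp [mul_add]) (by intros; simp)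
      (by intros; simp [add_mul]) (by intros; simp)
  have hΦ := LinearMap.ker_ne_bot_of_finrank_lt (f := Φ) (by
    rw [Subspace.dual_finrank_eq]; exact hK9)
  obtain ⟨a, ha, ha0⟩ := (Submodule.ne_bot_iff _).1 hΦ
  let Ψ : K →ₗ[F] F := auxT F D ∘ₗ LinearMap.mulLeft F a⁻¹ ∘ₗ K.val.toLinearMap
  obtain ⟨l, hl, hl0⟩ := (Submodule.ne_bot_iff _).1
    (LinearMap.ker_ne_bot_of_finrank_lt (f := Ψ) hK1)
  have hl0' : (l : D) ≠ 0 := by simpa using hl0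
  have hinj : Function.Injective (LinearMap.mulLeft F l) := by
    rw [injective_iff_map_eq_zero]
    intro m hm
    simpa [hl0] using hm
  obtain ⟨m, hm⟩ := LinearMap.injective_iff_surjective.1 hinj 1
  have hm' : (l : D) * m = 1 := by
    simpa using congrArg Subtype.val hm
  have hml : (m : D) = (l : D)⁻¹ := eq_inv_of_mul_eq_one_right hm'
  have t1 : auxT F D ((m : D) * a) = 0 := by
    have := LinearMap.congr_fun (LinearMap.mem_ker.1 ha) m
    simpa [Φ] using this
  have t2 : auxT F D ((m : D) * a)⁻¹ = 0 := by
    rw [hml, mul_inv_rev, inv_inv]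
    simpa [Ψ] using hl
  have hx : (m : D) * a ∉ (⊥ : Subalgebra F D) := by
    intro h
    obtain ⟨c, hcc⟩ := Algebra.mem_bot.1 h
    rw [← hcc, Algebra.algebraMap_eq_smul_one, map_smul, auxT_one hd, smul_eq_mul] at t1
    have h9 : (9 : F) ≠ 0 := by
      have : (9 : F) = 3 * 3 := by norm_num
      rw [this]; exact mul_ne_zero h3 h3
    have hc0 : c = 0 := by simpa [h9] using t1
    rw [hc0, map_zero] at hcc
    have := hcc.symm
    rw [hml] at this
    exact mul_ne_zero (inv_ne_zero hl0') ha0 this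
  exact ⟨_, hx, aux_cube_s3 h3 hd hc _ hx t1 t2⟩

lemma aux_div (h3 : (3 : F) ≠ 0) (hd : Module.finrank F D = 9)
    (hc : Subalgebra.center F D = ⊥) (ω : F) (hω3 : ω ^ 3 = 1) (hω : ω ≠ 1) :
    ∃ (α β : D) (c d : F), c ≠ 0 ∧ d ≠ 0 ∧ α ^ 3 = algebraMap F D c ∧
      β ^ 3 = algebraMap F D d ∧ α * β = ω • (β * α) := by
  obtain ⟨α, hα, c, hc0, hαc⟩ := aux_exists_alpha h3 hd hc
  have hα0 : α ≠ 0 := fun h => hα (h ▸ zero_mem _)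
  have hω0 : ω ≠ 0 := by rintro rfl; simp at hω3
  have hsum : 1 + ω + ω ^ 2 = 0 := by
    have : (ω - 1) * (1 + ω + ω ^ 2) = 0 := by linear_combination hω3
    exact (mul_eq_zero.1 this).resolve_left (sub_ne_zero.2 hω)
  have hβ : ∃ β : D, β ≠ 0 ∧ α * β = ω • (β * α) := by
    obtain ⟨u, hu⟩ : ∃ u : D, u * α ≠ α * u := by
      by_contra! h
      exact hα (hc ▸ Subalgebra.mem_center_iff.2 h)
    obtain ⟨v, hv⟩ : ∃ v, α * u = v * α := ⟨α * u * α⁻¹, by simp [hα0]⟩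
    obtain ⟨w, hw⟩ : ∃ w, α * v = w * α := ⟨α * v * α⁻¹, by simp [hα0]⟩
    have hwu : α * w = u * α := by
      have h1 : α ^ 3 * u = α * w * α ^ 2 := by
        calc α ^ 3 * u = α * (α * (α * u)) := by simp only [pow_succ, pow_zero, one_mul, mul_assoc]
          _ = α * w * α ^ 2 := by
            rw [hv, ← mul_assoc α v, hw]; simp only [pow_succ, pow_zero, one_mul, mul_assoc]
      rw [hαc, Algebra.commutes, ← hαc] at h1
      have h2 : u * α * α ^ 2 = α * w * α ^ 2 := by
        rw [← h1]; simp only [pow_succ, pow_zero, one_mul, mul_assoc]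
      exact (mul_right_cancel₀ (pow_ne_zero 2 hα0) h2).symm
    have e1 : α * (u + ω ^ 2 • v + ω • w) = ω • ((u + ω ^ 2 • v + ω • w) * α) := by
      simp only [mul_add, add_mul, mul_smul_comm, smul_mul_assoc, hv, hw, hwu, smul_add, smul_smul]
      rw [← pow_succ', hω3, one_smul, ← pow_two]; abel
    have e2 : α * (u + ω • v + ω ^ 2 • w) = ω ^ 2 • ((u + ω • v + ω ^ 2 • w) * α) := by
      simp only [mul_add, add_mul, mul_smul_comm, smul_mul_assoc, hv, hw, hwu, smul_add, smul_smul]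
      rw [← pow_succ, hω3, one_smul, ← pow_add, show 2 + 2 = 3 + 1 from rfl, pow_add ω 3 1, hω3,
        one_mul, pow_one]; abel
    by_cases h1 : u + ω ^ 2 • v + ω • w = 0
    · by_cases h2 : u + ω • v + ω ^ 2 • w = 0
      · exfalso
        apply hu
        have e0 : (3 : F) • u = u + v + w := by
          have hs : (u + v + w) = (u + v + w) + (u + ω ^ 2 • v + ω • w)
              + (u + ω • v + ω ^ 2 • w) := by rw [h1, h2]; simp
          have hs2 : (u + v + w) + (u + ω ^ 2 • v + ω • w) + (u + ω • v + ω ^ 2 • w)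
            = (3 : F) • u + (1 + ω + ω ^ 2) • v + (1 + ω + ω ^ 2) • w := by module
          rw [hs, hs2, hsum]; simp
        have e3 : (3 : F) • (u * α) = (3 : F) • (α * u) := by
          rw [← smul_mul_assoc, ← mul_smul_comm, e0]
          simp only [mul_add, add_mul, hv, hw, hwu]; abel
        exact smul_right_injective D h3 e3
      · refine ⟨_, mul_ne_zero h2 h2, ?_⟩
        generalize u + ω • v + ω ^ 2 • w = z at e2
        rw [← mul_assoc, e2, smul_mul_assoc, mul_assoc, e2, mul_smul_comm, smul_smul, ← pow_add,
          show 2 + 2 = 3 + 1 from rfl, pow_add ω 3 1, hω3, one_mul, pow_one, mul_assoc]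
    · exact ⟨_, h1, e1⟩
  obtain ⟨β, hβ0, hαβ⟩ := hβ
  have hb : β ∉ (⊥ : Subalgebra F D) := by
    intro h
    rw [← hc, Subalgebra.mem_center_iff] at h
    rw [h α] at hαβ
    have : (1 - ω) • (β * α) = 0 := by rw [sub_smul, one_smul, ← hαβ, sub_self]
    rcases smul_eq_zero.1 this with h | h
    · exact hω (sub_eq_zero.1 h).symm
    · exact mul_ne_zero hβ0 hα0 h
  have key : ∀ (z : D) (r : F), r ≠ 1 → α * z = r • (z * α) → auxT F D z = 0 := by
    intro z r hr h
    have h1 : auxT F D (α * (z * α⁻¹)) = auxT F D z := by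
      rw [auxT_comm, mul_assoc, inv_mul_cancel₀ hα0, mul_one]
    rw [← mul_assoc, h, smul_mul_assoc, mul_assoc, mul_inv_cancel₀ hα0, mul_one, map_smul,
      smul_eq_mul] at h1
    have : (r - 1) * auxT F D z = 0 := by linear_combination h1
    exact (mul_eq_zero.1 this).resolve_left (sub_ne_zero.2 hr)
  have t1 := key β ω hω hαβ
  have t2 := key β⁻¹ ω⁻¹ (by simpa using hω) (by
    have := congrArg (fun t => ω⁻¹ • (β⁻¹ * t * β⁻¹)) hαβ
    simp only [mul_smul_comm, smul_mul_assoc, smul_smul, inv_mul_cancel₀ hω0, one_smul] at this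
    rw [inv_mul_cancel_left₀ hβ0, mul_assoc, mul_assoc α, mul_inv_cancel₀ hβ0, mul_one] at this
    exact this.symm)
  obtain ⟨d, hd0, hβd⟩ := aux_cube_s3 h3 hd hc β hb t1 t2
  exact ⟨α, β, c, d, hc0, hd0, hαc, hβd, hαβ⟩

end div

/-- Existence of a pair of generators of a symbol algebra presentation. -/
def auxP (F A : Type*) [Field F] [Ring A] [Algebra F A] (ω : F) : Prop :=
  ∃ (α β : A) (c d : F), c ≠ 0 ∧ d ≠ 0 ∧ α ^ 3 = algebraMap F A c ∧
      β ^ 3 = algebraMap F A d ∧ α * β = ω • (β * α)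

lemma auxP_map {F A B : Type*} [Field F] [Ring A] [Algebra F A] [Ring B] [Algebra F B] {ω : F}
    (φ : A →ₐ[F] B) (h : auxP F A ω) : auxP F B ω := by
  obtain ⟨α, β, c, d, hc, hd, h1, h2, h3⟩ := h
  refine ⟨φ α, φ β, c, d, hc, hd, ?_, ?_, ?_⟩
  · rw [← map_pow, h1, AlgHom.commutes]
  · rw [← map_pow, h2, AlgHom.commutes]
  · rw [← map_mul, h3, map_smul, map_mul]

lemma auxP_matrix (F : Type*) [Field F] (ω : F) (hω3 : ω ^ 3 = 1) :
    auxP F (Matrix (Fin 3) (Fin 3) F) ω := by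
  refine ⟨Matrix.diagonal ![1, ω, ω ^ 2], !![0, 0, 1; 1, 0, 0; 0, 1, 0], 1, 1, one_ne_zero,
    one_ne_zero, ?_, ?_, ?_⟩
  · rw [Matrix.diagonal_pow, map_one, ← Matrix.diagonal_one]
    congr 1
    ext i
    fin_cases i
    · simp
    · simpa using hω3
    · simp only [Pi.pow_apply]
      change (ω ^ 2) ^ 3 = 1
      rw [← pow_mul, mul_comm, pow_mul, hω3, one_pow]
  · rw [map_one]
    ext i j
    fin_cases i <;> fin_cases j <;> simp [pow_succ, Matrix.mul_apply, Fin.sum_univ_three]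
  · ext i j
    have : 1 = ω * ω ^ 2 := by rw [← pow_succ', hω3]
    rw [Matrix.smul_apply, Matrix.diagonal_mul, Matrix.mul_diagonal, smul_eq_mul]
    fin_cases i <;> fin_cases j <;> simp [pow_two]
    linear_combination this

lemma auxP_of_csa (F A : Type*) [Field F] [Ring A] [Algebra F A]
    (h3 : (3 : F) ≠ 0) (ω : F) (hω3 : ω ^ 3 = 1) (hω : ω ≠ 1)
    [Algebra.IsCentral F A] [IsSimpleRing A] (hdim : Module.finrank F A = 9) : auxP F A ω := by
  have hfin : Module.Finite F A := FiniteDimensional.of_finrank_pos (by omega)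
  have hart : IsArtinianRing A := IsArtinianRing.of_finite F A
  obtain ⟨n, hn, D, _, _, _, ⟨e⟩⟩ :=
    IsSimpleRing.exists_algEquiv_matrix_divisionRing_finite F A
  have hd := e.toLinearEquiv.finrank_eq
  rw [hdim, Module.finrank_matrix, Fintype.card_fin] at hd
  have hn' : n = 1 ∨ n = 3 := by
    have hdv : n * n ∣ 9 := ⟨_, hd⟩
    have hle : n * n ≤ 9 := Nat.le_of_dvd (by norm_num) hdv
    have hle' : n ≤ 3 := by nlinarith
    interval_cases n
    · exact absurd rfl hn.out
    · exact Or.inl rfl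
    · exact absurd hdv (by norm_num)
    · exact Or.inr rfl
  rcases hn' with rfl | rfl
  · let e' : A ≃ₐ[F] D := e.trans (by
      convert! (Matrix.uniqueAlgEquiv (m := Fin 1) (R := F) (A := D)))
    have hD : Module.finrank F D = 9 := by omega
    have hc : Subalgebra.center F D = ⊥ := by
      have : Algebra.IsCentral F D := Algebra.IsCentral.of_algEquiv F A D e'
      exact Algebra.IsCentral.center_eq_bot F D
    exact auxP_map (e'.symm : D →ₐ[F] A) (aux_div h3 hD hc ω hω3 hω)
  · exact auxP_map (e.symm : _ →ₐ[F] A)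
      (auxP_map (Algebra.ofId F D).mapMatrix (auxP_matrix F ω hω3))

/-- The homomorphism from `ℤ/3` determined by an element of cube one. -/
lemma aux_hom {G : Type*} [Group G] (g : G) (hg : g ^ 3 = 1) :
    ∃ f : Multiplicative (ZMod 3) →* G, ∀ k : ℕ, f (Multiplicative.ofAdd (k : ZMod 3)) = g ^ k := by
  let φ : ZMod 3 →+ Additive G := ZMod.lift 3 ⟨zmultiplesHom (Additive G) (Additive.ofMul g), by
    simp only [zmultiplesHom_apply, natCast_zsmul]
    rw [← ofMul_pow, hg, ofMul_one]⟩
  refine ⟨AddMonoidHom.toMultiplicativeLeft φ, fun k => ?_⟩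
  change (φ (k : ZMod 3)).toMul = g ^ k
  have : φ ((k : ℤ) : ZMod 3) = Additive.ofMul (g ^ k) := by
    rw [ZMod.lift_coe]
    simp [ofMul_pow]
  rw [Int.cast_natCast] at this
  rw [this]; rfl

lemma aux_mem_projUnits {F A : Type*} [Field F] [Ring A] [Algebra F A] {u : Aˣ} :
    u ∈ projUnits F A ↔ ∃ c : Fˣ, algebraMap F A c = u := by
  constructor
  · rintro ⟨c, rfl⟩; exact ⟨c, rfl⟩
  · rintro ⟨c, hc⟩; exact ⟨c, Units.ext hc⟩

/-- Let `F` be a field of characteristic different from `3` containing a nontrivial cube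
root of unity `ω`, and let `A` be a central simple `F`-algebra of dimension `9`. Then
`(ℤ/3ℤ)²` embeds into `A^×/F^×`; moreover one can find non-scalar `α, β ∈ A^×` with scalar
cubes and `α β = ω (β α)` whose images generate this subgroup. -/
theorem stmt_3 (F A : Type*) [Field F] [Ring A] [Algebra F A]
    (hchar : (3 : F) ≠ 0)
    (ω : F) (hω3 : ω ^ 3 = 1) (hω : ω ≠ 1)
    [Algebra.IsCentral F A] [IsSimpleRing A]
    (hdim : Module.finrank F A = 9) :
    ∃ α β : Aˣ,
      α ∉ projUnits F A ∧ β ∉ projUnits F A ∧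
      α ^ 3 ∈ projUnits F A ∧ β ^ 3 ∈ projUnits F A ∧
      ((↑α : A) * ↑β = algebraMap F A ω * (↑β * ↑α)) ∧
      ∃ f : (Multiplicative (ZMod 3) × Multiplicative (ZMod 3)) →* (Aˣ ⧸ projUnits F A),
        Function.Injective f ∧
        f (Multiplicative.ofAdd 1, 1) = QuotientGroup.mk α ∧ f (1, Multiplicative.ofAdd 1) = QuotientGroup.mk β := by
  obtain ⟨a, b, c, d, hc, hd, ha3, hb3, hab⟩ := auxP_of_csa F A hchar ω hω3 hω hdim
  have mkunit : ∀ (x : A) (r : F), r ≠ 0 → x ^ 3 = algebraMap F A r → ∃ u : Aˣ, (u : A) = x := by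
    intro x r hr hx
    have : IsUnit (x ^ 3) := hx ▸ (IsUnit.mk0 r hr).map (algebraMap F A)
    exact (isUnit_pow_iff (by norm_num)).1 this
  obtain ⟨α, rfl⟩ := mkunit a c hc ha3
  obtain ⟨β, rfl⟩ := mkunit b d hd hb3
  have hω0 : ω ≠ 0 := by rintro rfl; simp at hω3
  have hα3 : α ^ 3 ∈ projUnits F A :=
    aux_mem_projUnits.2 ⟨Units.mk0 c hc, by simp [ha3]⟩
  have hβ3 : β ^ 3 ∈ projUnits F A :=
    aux_mem_projUnits.2 ⟨Units.mk0 d hd, by simp [hb3]⟩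
  -- the scalar `ω` as a unit of `A`
  let w : Aˣ := Units.map (algebraMap F A).toMonoidHom (Units.mk0 ω hω0)
  have hwc : ∀ u : Aˣ, Commute w u := fun u => Units.ext (Algebra.commutes ω (u : A))
  have hwmem : w ∈ projUnits F A := ⟨_, rfl⟩
  have hαβ : α * β = w * (β * α) := Units.ext (by
    change (α : A) * β = algebraMap F A ω * (β * α)
    rw [hab, Algebra.smul_def])
  have hwk : ∀ k : ℕ, w ^ k = 1 → (k : ZMod 3) = 0 := by
    intro k hk
    have h1 : algebraMap F A (ω ^ k) = algebraMap F A 1 := by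
      rw [map_pow, map_one]; exact congrArg Units.val hk
    have h2 : ω ^ k = 1 := (algebraMap F A).injective h1
    have h3 : orderOf ω = 3 := orderOf_eq_prime hω3 hω
    rw [ZMod.natCast_eq_zero_iff, ← h3]
    exact orderOf_dvd_of_pow_eq_one h2
  have hscal : ∀ u ∈ projUnits F A, ∀ v : Aˣ, u * v = v * u := by
    rintro _ ⟨r, rfl⟩ v
    exact Units.ext (Algebra.commutes (r : F) (v : A))
  have c1 : ∀ j : ℕ, α * β ^ j = w ^ j * (β ^ j * α) := by
    intro j
    induction j with
    | zero => simp
    | succ j ih =>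
      calc α * β ^ (j + 1) = (α * β ^ j) * β := by rw [pow_succ, mul_assoc]
        _ = w ^ j * β ^ j * (α * β) := by rw [ih]; simp only [mul_assoc]
        _ = w ^ j * (β ^ j * w) * (β * α) := by rw [hαβ]; simp only [mul_assoc]
        _ = w ^ (j + 1) * (β ^ (j + 1) * α) := by
          rw [← (hwc (β ^ j)).eq]; simp only [pow_succ, mul_assoc]
  have c2 : ∀ i : ℕ, α ^ i * β = w ^ i * (β * α ^ i) := by
    intro i
    induction i with
    | zero => simp
    | succ i ih =>
      calc α ^ (i + 1) * β = α * (α ^ i * β) := by rw [pow_succ', mul_assoc]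
        _ = (α * w ^ i) * (β * α ^ i) := by rw [ih]; simp only [mul_assoc]
        _ = w ^ i * (α * β) * α ^ i := by
          rw [← ((hwc α).pow_left i).eq]; simp only [mul_assoc]
        _ = w ^ (i + 1) * (β * α ^ (i + 1)) := by
          rw [hαβ, pow_succ w, pow_succ' α]; simp only [mul_assoc]
  have hker : ∀ i j : ℕ, α ^ i * β ^ j ∈ projUnits F A → (i : ZMod 3) = 0 ∧ (j : ZMod 3) = 0 := by
    intro i j h
    constructor
    · apply hwk
      have h1 := hscal _ h β
      have h2 : α ^ i * β ^ j * β = w ^ i * (β * (α ^ i * β ^ j)) := by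
        rw [mul_assoc, ← pow_succ, pow_succ', ← mul_assoc, c2]; simp only [mul_assoc]
      rw [h2] at h1
      exact mul_eq_right.1 h1
    · apply hwk
      have h1 := hscal _ h α
      have h2 : α * (α ^ i * β ^ j) = w ^ j * (α ^ i * β ^ j * α) := by
        rw [← mul_assoc, ← pow_succ', pow_succ, mul_assoc, c1, ← mul_assoc,
          ← ((hwc (α ^ i)).pow_left j).eq]; simp only [mul_assoc]
      rw [h2] at h1
      exact mul_eq_right.1 h1.symm
  have h10 : ((1 : ℕ) : ZMod 3) ≠ 0 := by decide
  refine ⟨α, β, fun h => h10 (hker 1 0 (by simpa using h)).1,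
    fun h => h10 (hker 0 1 (by simpa using h)).2, hα3, hβ3, ?_, ?_⟩
  · rw [hab, Algebra.smul_def]
  obtain ⟨f, hf⟩ := aux_hom (QuotientGroup.mk α : Aˣ ⧸ projUnits F A)
    (by rw [← QuotientGroup.mk_pow]; exact (QuotientGroup.eq_one_iff _).2 hα3)
  obtain ⟨g, hg⟩ := aux_hom (QuotientGroup.mk β : Aˣ ⧸ projUnits F A)
    (by rw [← QuotientGroup.mk_pow]; exact (QuotientGroup.eq_one_iff _).2 hβ3)
  have hcomm : Commute (QuotientGroup.mk α : Aˣ ⧸ projUnits F A) (QuotientGroup.mk β) := by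
    change (QuotientGroup.mk α : Aˣ ⧸ projUnits F A) * QuotientGroup.mk β
      = QuotientGroup.mk β * QuotientGroup.mk α
    rw [← QuotientGroup.mk_mul, ← QuotientGroup.mk_mul, hαβ, QuotientGroup.mk_mul _ w,
      (QuotientGroup.eq_one_iff w).2 hwmem, one_mul]
  have hrep : ∀ x : Multiplicative (ZMod 3), ∃ k : ℕ, x = Multiplicative.ofAdd (k : ZMod 3) :=
    fun x => ⟨(Multiplicative.toAdd x).val, by rw [ZMod.natCast_zmod_val]; rfl⟩
  refine ⟨MonoidHom.noncommCoprod f g ?_, ?_, ?_, ?_⟩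
  · intro m n
    obtain ⟨i, rfl⟩ := hrep m
    obtain ⟨j, rfl⟩ := hrep n
    rw [hf, hg]
    exact hcomm.pow_pow i j
  · rw [injective_iff_map_eq_one]
    rintro ⟨m, n⟩ h
    obtain ⟨i, rfl⟩ := hrep m
    obtain ⟨j, rfl⟩ := hrep n
    rw [MonoidHom.noncommCoprod_apply] at h
    simp only [hf, hg] at h
    rw [← QuotientGroup.mk_pow, ← QuotientGroup.mk_pow, ← QuotientGroup.mk_mul] at h
    obtain ⟨h1, h2⟩ := hker i j ((QuotientGroup.eq_one_iff _).1 h)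
    rw [h1, h2]; rfl
  · rw [MonoidHom.noncommCoprod_apply, map_one g, mul_one]
    simpa using hf 1
  · rw [MonoidHom.noncommCoprod_apply, map_one f, one_mul]
    simpa using hg 1
end

section
/- Let F be a field of characteristic different from 3, and let D be a division ring that is a central F-algebra with dim_F D = 9. If the quotient group D^×/F^× contains an element of prime order p with p ≠ 3, then p ≡ 1 (mod 3). -/
theorem comm_case (F K : Type*) [Field F] [Field K] [Algebra F K]
    (hK : Module.finrank F K = 3) (p : ℕ) (hp : p.Prime) (hp3 : p ≠ 3)
    (r : K) (hr : r ∉ (algebraMap F K).range) (a : F) (hra : r ^ p = algebraMap F K a) :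
    p % 3 = 1 := by
  have : FiniteDimensional F K := Module.finite_of_finrank_pos (by omega)
  have : NeZero p := ⟨hp.ne_zero⟩
  have : Fact p.Prime := ⟨hp⟩
  have hr0 : r ≠ 0 := by
    rintro rfl
    exact hr ⟨0, map_zero _⟩
  have ha0 : a ≠ 0 := by
    rintro rfl
    rw [map_zero] at hra
    exact hr0 (pow_eq_zero_iff hp.ne_zero |>.1 hra)
  have hN : (Algebra.norm F r) ^ p = a ^ 3 := by
    rw [← map_pow, hra, Algebra.norm_algebraMap, hK]
  have hN0 : Algebra.norm F r ≠ 0 := by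
    rwa [Ne, Algebra.norm_eq_zero_iff]
  -- `a` is a `p`-th power
  have hcop : IsCoprime (3 : ℤ) (p : ℤ) := by
    have := (Nat.coprime_primes Nat.prime_three hp).2 (Ne.symm hp3)
    exact_mod_cast Nat.isCoprime_iff_coprime.2 this
  obtain ⟨u, v, huv⟩ := hcop
  obtain ⟨b, hb0, hb⟩ : ∃ b : F, b ≠ 0 ∧ b ^ p = a := by
    refine ⟨(Algebra.norm F r) ^ u * a ^ v, mul_ne_zero (zpow_ne_zero _ hN0) (zpow_ne_zero _ ha0), ?_⟩
    have h1 : ((Algebra.norm F r) ^ u) ^ p = (a ^ (3 : ℤ)) ^ u := by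
      rw [← zpow_natCast, ← zpow_mul, mul_comm u, zpow_mul, zpow_natCast, hN]
      norm_cast
    rw [mul_pow, h1, ← zpow_natCast (a ^ v), ← zpow_mul, ← zpow_mul, ← zpow_add₀ ha0]
    rw [mul_comm 3 u, huv, zpow_one]
  have hb0' : algebraMap F K b ≠ 0 := by simpa using hb0
  set z : K := r / algebraMap F K b with hz
  have hzp : z ^ p = 1 := by
    rw [hz, div_pow, hra, ← map_pow, hb, div_self]
    simpa using ha0
  have hzF : z ∉ (⊥ : Subalgebra F K) := by
    rintro hmem
    obtain ⟨c, hc⟩ := Algebra.mem_bot.1 hmem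
    refine hr ⟨c * b, ?_⟩
    rw [map_mul, hc, hz, div_mul_cancel₀ _ hb0']
  have hz1 : z ≠ 1 := by
    intro h
    exact hzF (h ▸ one_mem _)
  have hprim : IsPrimitiveRoot z p := by
    have := IsPrimitiveRoot.orderOf z
    rwa [orderOf_eq_prime hzp hz1] at this
  have := Subalgebra.isSimpleOrder_of_finrank_prime F K (by rw [hK]; exact Nat.prime_three)
  have : IsCyclotomicExtension {p} F K := by
    rw [IsCyclotomicExtension.iff_singleton]
    refine ⟨⟨z, hprim⟩, fun x => ?_⟩
    have hmem : z ∈ Algebra.adjoin F {b : K | b ^ p = 1} := Algebra.subset_adjoin hzp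
    rcases eq_bot_or_eq_top (Algebra.adjoin F {b : K | b ^ p = 1}) with h | h
    · exact absurd (h ▸ hmem) hzF
    · rw [h]; trivial
  have : IsGalois F K := IsCyclotomicExtension.isGalois {p} F K
  have hdvd : Nat.card (K ≃ₐ[F] K) ∣ Nat.card (ZMod p)ˣ :=
    Subgroup.card_dvd_of_injective _ (IsPrimitiveRoot.autToPow_injective F hprim)
  rw [IsGalois.card_aut_eq_finrank, hK, Nat.card_eq_fintype_card, ZMod.card_units] at hdvd
  have := hp.two_le
  omega

/-- Let `F` be a field of characteristic different from `3` and `D` a central division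
`F`-algebra of dimension `9`. If `D^×/F^×` contains an element of prime order `p ≠ 3`,
then `p ≡ 1 (mod 3)`. -/
theorem stmt_4 (F D : Type*) [Field F] [DivisionRing D] [Algebra F D]
    (hchar : (3 : F) ≠ 0)
    [Algebra.IsCentral F D]
    (hdim : Module.finrank F D = 9)
    (p : ℕ) (hp : p.Prime) (hp3 : p ≠ 3)
    (g : Dˣ ⧸ projUnits F D) (hg : orderOf g = p) :
    p % 3 = 1 := by
  have : FiniteDimensional F D := Module.finite_of_finrank_pos (by omega)
  obtain ⟨x, rfl⟩ := QuotientGroup.mk_surjective g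
  have hpow : (x : Dˣ ⧸ projUnits F D) ^ p = 1 := hg ▸ pow_orderOf_eq_one _
  rw [← QuotientGroup.mk_pow, QuotientGroup.eq_one_iff] at hpow
  obtain ⟨a, ha⟩ := hpow
  have ha' : algebraMap F D a = (x : D) ^ p := by
    simpa using congrArg Units.val ha
  have hx : (x : D) ∉ (algebraMap F D).range := by
    rintro ⟨c, hc⟩
    have hc0 : c ≠ 0 := by
      rintro rfl
      rw [map_zero] at hc
      exact x.ne_zero hc.symm
    have : (x : Dˣ ⧸ projUnits F D) = 1 := by
      rw [QuotientGroup.eq_one_iff]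
      exact ⟨Units.mk0 c hc0, Units.ext hc⟩
    rw [this, orderOf_one] at hg
    exact hp.one_lt.ne hg
  have hint : IsIntegral F (x : D) := Algebra.IsIntegral.isIntegral _
  have : Fact (Irreducible (minpoly F (x : D))) := ⟨minpoly.irreducible hint⟩
  let K := AdjoinRoot (minpoly F (x : D))
  have hne := minpoly.ne_zero hint
  let φ : K →ₐ[F] D := Ideal.Quotient.liftₐ _ (Polynomial.aeval (x : D)) (by
    intro q hq
    obtain ⟨y, rfl⟩ := Ideal.mem_span_singleton.1 hq
    rw [map_mul, minpoly.aeval, zero_mul])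
  have hφr : φ (AdjoinRoot.root _) = x := by
    change Polynomial.aeval (x : D) Polynomial.X = x
    simp
  have hφinj : Function.Injective φ := φ.toRingHom.injective
  have : FiniteDimensional F K := Module.Finite.of_injective φ.toLinearMap hφinj
  let : Module K D := Module.compHom D φ.toRingHom
  have : IsScalarTower F K D := ⟨fun c k d => by
    change φ (c • k) * d = c • (φ k * d)
    rw [map_smul, smul_mul_assoc]⟩
  have hmul : Module.finrank F K * Module.finrank K D = 9 := by
    rw [Module.finrank_mul_finrank, hdim]
  have hdvd : Module.finrank F K ∣ 3 ^ 2 := ⟨_, hmul.symm⟩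
  have hrK : AdjoinRoot.root (minpoly F (x : D)) ∉ (algebraMap F K).range := by
    rintro ⟨c, hc⟩
    refine hx ⟨c, ?_⟩
    rw [← hφr, ← hc]
    exact (φ.commutes c).symm
  have hK3 : Module.finrank F K = 3 := by
    obtain ⟨i, hi, h⟩ := (Nat.dvd_prime_pow Nat.prime_three).1 hdvd
    interval_cases i
    · exfalso
      have hb := Subalgebra.bot_eq_top_of_finrank_eq_one (F := F) (E := K) (by simpa using h)
      have : AdjoinRoot.root (minpoly F (x : D)) ∈ (⊥ : Subalgebra F K) := hb ▸ Algebra.mem_top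
      obtain ⟨c, hc⟩ := Algebra.mem_bot.1 this
      exact hrK ⟨c, hc⟩
    · simpa using h
    · exfalso
      have hsurj : Function.Surjective φ := by
        have := (LinearMap.injective_iff_surjective_of_finrank_eq_finrank
          (f := φ.toLinearMap) (by rw [h, hdim]; norm_num)).1 hφinj
        exact this
      have hxc : (x : D) ∈ Subalgebra.center F D := by
        rw [Subalgebra.mem_center_iff]
        intro d
        obtain ⟨k, rfl⟩ := hsurj d
        have hcomm := congrArg φ (mul_comm k (AdjoinRoot.root (minpoly F (x : D))))
        rw [map_mul, map_mul, hφr] at hcomm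
        exact hcomm
      obtain ⟨c, hc⟩ := Algebra.mem_bot.1 (Algebra.IsCentral.out hxc)
      exact hx ⟨c, hc⟩
  refine comm_case F K hK3 p hp hp3 _ hrK a (hφinj ?_)
  rw [map_pow, hφr, φ.commutes, ha']
end

section
/- Let F be a field of characteristic different from 3 that contains no nontrivial cube root of unity. Then there is no injective group homomorphism from (ℤ/3ℤ)³ into GL₄(F), the group of invertible 4×4 matrices over F. -/
section aux
variable {F V G : Type*} [Field F] [AddCommGroup V] [Module F V] [CommGroup G]

lemma aux_comm (f : G →* Module.End F V) (a b : G) (v : V) : f a (f b v) = f b (f a v) := by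
  rw [← Module.End.mul_apply, ← Module.End.mul_apply, ← map_mul, ← map_mul, mul_comm]

lemma aux_cube_s6 (f : G →* Module.End F V) (hG : ∀ g : G, g ^ 3 = 1) (a : G) (v : V) :
    f a (f a (f a v)) = v := by
  rw [← Module.End.mul_apply, ← Module.End.mul_apply, ← map_mul, ← map_mul, ← pow_two,
    ← pow_succ, hG]
  simp

lemma aux_pick (f : G →* Module.End F V) (hG : ∀ g : G, g ^ 3 = 1) (a b : G)
    (S : Submodule F V) (hS : ∀ g, ∀ v ∈ S, f g v ∈ S)
    (ha : ∀ v ∈ S, f a (f a v) + f a v + v = 0) (v : V) (hv : v ∈ S) (hv0 : v ≠ 0) :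
    ∃ i : ℕ, ∃ w ∈ S, w ≠ 0 ∧ f (b * a ^ i) w = w := by
  by_cases h1 : f b v - v = 0
  · exact ⟨0, v, hv, hv0, by simpa [sub_eq_zero] using h1⟩
  have m1 : f b v - v ∈ S := S.sub_mem (hS _ _ hv) hv
  by_cases h2 : f b (f a (f b v - v)) - (f b v - v) = 0
  · exact ⟨1, _, m1, h1, by simpa only [pow_one, map_mul, Module.End.mul_apply, sub_eq_zero] using h2⟩
  have m2 : f b (f a (f b v - v)) - (f b v - v) ∈ S := S.sub_mem (hS _ _ (hS _ _ m1)) m1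
  refine ⟨2, _, m2, h2, ?_⟩
  have e1 := ha (f b v) (hS _ _ hv)
  have e2 := ha (f b (f b v)) (hS _ _ (hS _ _ hv))
  have e3 := aux_cube_s6 f hG b v
  have e4 := aux_cube_s6 f hG a v
  have e5 := aux_cube_s6 f hG a (f b v)
  have e6 := aux_cube_s6 f hG a (f b (f b v))
  have c : ∀ v, f b (f a v) = f a (f b v) := fun v => aux_comm f b a v
  rw [← sub_eq_zero]
  simp only [pow_two, map_mul, Module.End.mul_apply, map_sub, c, e3, e4, e5, e6] at *
  linear_combination (norm := abel) e1 - e2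

lemma aux_dim [FiniteDimensional F V] (hchar : (3 : F) ≠ 0)
    (hcube : ∀ x : F, x ^ 3 = 1 → x = 1) (T : Module.End F V)
    (S : Submodule F V) (hS : ∀ v ∈ S, T v ∈ S)
    (ha : ∀ v ∈ S, T (T v) + T v + v = 0) (v : V) (hv : v ∈ S) (hv0 : v ≠ 0) :
    2 ≤ Module.finrank F S := by
  have hli : LinearIndependent F ![(⟨v, hv⟩ : S), ⟨T v, hS v hv⟩] := by
    rw [LinearIndependent.pair_iff' (by simpa [Subtype.ext_iff] using hv0)]
    intro x hx
    have hx : x • v = T v := congrArg Subtype.val hx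
    have h := ha v hv
    rw [← hx, map_smul, ← hx] at h
    have h' : (x * x + x + 1) • v = 0 := by rw [← h]; module
    have h2 := (smul_eq_zero.1 h').resolve_right hv0
    have h3 := hcube x (by linear_combination (x - 1) * h2)
    subst h3
    exact hchar (by linear_combination h2)
  simpa using hli.fintype_card_le_finrank

lemma aux_exists (f : G →* Module.End F V) (hG : ∀ g : G, g ^ 3 = 1)
    (hf : Function.Injective f) (a : G) (ha : a ≠ 1) :
    ∃ v ≠ 0, f a (f a v) + f a v + v = 0 := by
  have : f a ≠ 1 := fun h => ha (hf (by simpa using h))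
  obtain ⟨w, hw⟩ : ∃ w, f a w ≠ w := by
    by_contra! h
    exact this (LinearMap.ext h)
  refine ⟨f a w - w, sub_ne_zero.2 hw, ?_⟩
  simp only [map_sub, aux_cube_s6 f hG]
  abel

lemma aux_main [FiniteDimensional F V] (hV : Module.finrank F V = 4) (hchar : (3 : F) ≠ 0)
    (hcube : ∀ x : F, x ^ 3 = 1 → x = 1)
    (f : G →* Module.End F V) (hG : ∀ g : G, g ^ 3 = 1)
    (hf : Function.Injective f) (a b c : G) (ha : a ≠ 1) (hb : ∀ i : ℕ, b * a ^ i ≠ 1) :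
    ∃ i j k : ℕ, c * a ^ j * (b * a ^ i) ^ k = 1 := by
  let W : G → Submodule F V := fun a => LinearMap.ker (f a * f a + f a + 1)
  let U : G → Submodule F V := fun a => LinearMap.ker (f a - 1)
  have mW : ∀ a v, v ∈ W a ↔ f a (f a v) + f a v + v = 0 := fun a v => by simp [W]
  have mU : ∀ a v, v ∈ U a ↔ f a v = v := fun a v => by simp [U, sub_eq_zero]
  have iW : ∀ a g v, v ∈ W a → f g v ∈ W a := fun a g v h => by
    rw [mW] at h ⊢
    rw [aux_comm f a g, aux_comm f a g, ← map_add, ← map_add, h, map_zero]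
  have iU : ∀ a g v, v ∈ U a → f g v ∈ U a := fun a g v h => by
    rw [mU] at h ⊢
    rw [aux_comm f a g, h]
  obtain ⟨v, hv0, hv⟩ := aux_exists f hG hf a ha
  obtain ⟨i, w, hw, hw0, hbw⟩ := aux_pick f hG a b (W a) (iW a) (fun v => (mW a v).1) v
    ((mW a v).2 hv) hv0
  obtain ⟨j, x, hx, hx0, hcx⟩ := aux_pick f hG a c (W a ⊓ U (b * a ^ i))
    (fun g v h => ⟨iW _ _ _ h.1, iU _ _ _ h.2⟩) (fun v h => (mW a v).1 h.1) w
    ⟨hw, (mU _ _).2 hbw⟩ hw0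
  obtain ⟨y, hy0, hy⟩ := aux_exists f hG hf (b * a ^ i) (hb i)
  obtain ⟨k, z, hz, hz0, hcz⟩ := aux_pick f hG (b * a ^ i) (c * a ^ j) (W (b * a ^ i)) (iW _)
    (fun v => (mW _ v).1) y ((mW _ y).2 hy) hy0
  refine ⟨i, j, k, ?_⟩
  generalize b * a ^ i = b' at *
  generalize c * a ^ j = c' at *
  have d1 := aux_dim hchar hcube (f a) (W a ⊓ U b' ⊓ U c')
    (fun v h => ⟨⟨iW _ _ _ h.1.1, iU _ _ _ h.1.2⟩, iU _ _ _ h.2⟩)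
    (fun v h => (mW a v).1 h.1.1) x ⟨hx, (mU _ _).2 hcx⟩ hx0
  have d2 := aux_dim hchar hcube (f b') (W b' ⊓ U (c' * b' ^ k))
    (fun v h => ⟨iW _ _ _ h.1, iU _ _ _ h.2⟩)
    (fun v h => (mW _ v).1 h.1) z ⟨hz, (mU _ _).2 hcz⟩ hz0
  have hdis : (W a ⊓ U b' ⊓ U c') ⊓ (W b' ⊓ U (c' * b' ^ k)) = ⊥ := by
    rw [eq_bot_iff]
    rintro v ⟨⟨⟨-, h1⟩, -⟩, ⟨h2, -⟩⟩
    have h1 := (mU _ _).1 h1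
    have h2 := (mW _ _).1 h2
    rw [h1, h1] at h2
    have h3 : (3 : F) • v = 0 := by rw [← h2]; module
    exact (smul_eq_zero.1 h3).resolve_left hchar
  have hsum := Submodule.finrank_sup_add_finrank_inf_eq (W a ⊓ U b' ⊓ U c')
    (W b' ⊓ U (c' * b' ^ k))
  rw [hdis, finrank_bot] at hsum
  have hle : (W a ⊓ U b' ⊓ U c') ⊔ (W b' ⊓ U (c' * b' ^ k)) ≤ U (c' * b' ^ k) := by
    refine sup_le ?_ inf_le_right
    rintro v ⟨⟨-, h1⟩, h2⟩
    have h1 := (mU _ _).1 h1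
    have h2 := (mU _ _).1 h2
    rw [mU]
    have : ∀ k : ℕ, f (b' ^ k) v = v := by
      intro k
      induction k with
      | zero => simp
      | succ k ih => rw [pow_succ, map_mul, Module.End.mul_apply, h1, ih]
    rw [map_mul, Module.End.mul_apply, this, h2]
  have hfr := Submodule.finrank_mono hle
  have htop : U (c' * b' ^ k) = ⊤ := by
    apply Submodule.eq_top_of_finrank_eq
    have := Submodule.finrank_le (U (c' * b' ^ k))
    omega
  apply hf
  rw [map_one]
  ext v
  exact (mU _ _).1 (htop ▸ Submodule.mem_top)

end aux


/-- Let `F` be a field of characteristic different from `3` that contains no nontrivial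
cube root of unity. Then there is no injective group homomorphism from `(ℤ/3ℤ)³` into
`GL₄(F)`, the group of invertible `4 × 4` matrices over `F`. -/
theorem stmt_6 (F : Type*) [Field F]
    (hchar : (3 : F) ≠ 0)
    (hcube : ∀ x : F, x ^ 3 = 1 → x = 1) :
    ¬ ∃ f : (Multiplicative (ZMod 3) × Multiplicative (ZMod 3) × Multiplicative (ZMod 3)) →* (Matrix (Fin 4) (Fin 4) F)ˣ,
      Function.Injective f := by
  rintro ⟨f, hf⟩
  let e : Matrix (Fin 4) (Fin 4) F →* Module.End F (Fin 4 → F) :=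
    (Matrix.toLinAlgEquiv' : Matrix (Fin 4) (Fin 4) F ≃ₐ[F] _).toRingEquiv.toMulEquiv.toMonoidHom
  have he : Function.Injective e :=
    (Matrix.toLinAlgEquiv' : Matrix (Fin 4) (Fin 4) F ≃ₐ[F] _).injective
  let t : Multiplicative (ZMod 3) := Multiplicative.ofAdd 1
  have ht : t ≠ 1 := by decide
  obtain ⟨i, j, k, h⟩ := aux_main (by simp) hchar hcube
    (e.comp ((Units.coeHom _).comp f)) (by decide)
    (he.comp (Units.val_injective.comp hf)) (t, 1, 1) (1, t, 1) (1, 1, t)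
    (fun h => ht (congrArg Prod.fst h))
    (fun i h => ht (by simpa using congrArg (fun p => p.2.1) h))
  exact ht (by simpa using congrArg (fun p => p.2.2) h)
end

section
/- Let F be a field of characteristic different from 3 and let L be a field extension of F with [L : F] = 3, generated over F by an element x̄ (i.e., L = F(x̄)) satisfying x̄³ = α for some nonzero α ∈ F. Suppose ȳ ∈ L satisfies ȳ³ = β for some nonzero β ∈ F. Then there exists a nonzero c ∈ F such that ȳ = c, or ȳ = c·x̄, or ȳ = c·x̄². -/
/-- Let `F` be a field of characteristic different from `3` and `L = F(x)` an extension of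
degree `3` with `x³ = α ∈ F^×`. If `y ∈ L` satisfies `y³ = β ∈ F^×`, then `y = c`, or
`y = c·x`, or `y = c·x²` for some nonzero `c ∈ F`. -/
theorem stmt_7 (F L : Type*) [Field F] [Field L] [Algebra F L]
    (hchar : (3 : F) ≠ 0)
    (hdeg : Module.finrank F L = 3)
    (x : L) (hgen : Algebra.adjoin F {x} = ⊤)
    (α : F) (hα : α ≠ 0) (hx : x ^ 3 = algebraMap F L α)
    (y : L) (β : F) (hβ : β ≠ 0) (hy : y ^ 3 = algebraMap F L β) :
    ∃ c : F, c ≠ 0 ∧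
      (y = algebraMap F L c ∨ y = algebraMap F L c * x ∨ y = algebraMap F L c * x ^ 2) := by
  have hsp : ∀ z : L, ∃ a b c : F,
      z = algebraMap F L a + algebraMap F L b * x + algebraMap F L c * x ^ 2 := by
    intro z
    have hz : z ∈ Algebra.adjoin F {x} := by rw [hgen]; trivial
    induction hz using Algebra.adjoin_induction with
    | mem u hu =>
      rw [Set.mem_singleton_iff] at hu
      exact ⟨0, 1, 0, by simp [hu]⟩
    | algebraMap r => exact ⟨r, 0, 0, by simp⟩
    | add u v _ _ hu hv =>
      obtain ⟨a, b, c, rfl⟩ := hu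
      obtain ⟨a', b', c', rfl⟩ := hv
      exact ⟨a + a', b + b', c + c', by simp only [map_add]; ring⟩
    | mul u v _ _ hu hv =>
      obtain ⟨a, b, c, rfl⟩ := hu
      obtain ⟨a', b', c', rfl⟩ := hv
      refine ⟨a * a' + α * (b * c' + c * b'), a * b' + b * a' + α * (c * c'),
        a * c' + b * b' + c * a', ?_⟩
      simp only [map_add, map_mul, ← hx]
      ring
  have hli : LinearIndependent F ![(1 : L), x, x ^ 2] := by
    apply linearIndependent_of_top_le_span_of_card_eq_finrank
    · intro z _
      obtain ⟨a, b, c, rfl⟩ := hsp z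
      have h0 : (1 : L) ∈ Submodule.span F (Set.range ![(1 : L), x, x ^ 2]) :=
        Submodule.subset_span ⟨0, rfl⟩
      have h1 : x ∈ Submodule.span F (Set.range ![(1 : L), x, x ^ 2]) :=
        Submodule.subset_span ⟨1, rfl⟩
      have h2 : x ^ 2 ∈ Submodule.span F (Set.range ![(1 : L), x, x ^ 2]) :=
        Submodule.subset_span ⟨2, rfl⟩
      have := add_mem (add_mem (Submodule.smul_mem _ a h0) (Submodule.smul_mem _ b h1))
        (Submodule.smul_mem _ c h2)
      simpa [Algebra.smul_def] using this
    · simp [hdeg]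
  have key : ∀ a b c : F,
      algebraMap F L a + algebraMap F L b * x + algebraMap F L c * x ^ 2 = 0 →
      a = 0 ∧ b = 0 ∧ c = 0 := by
    intro a b c h
    have := Fintype.linearIndependent_iff.1 hli ![a, b, c] (by
      simpa [Fin.sum_univ_three, Algebra.smul_def] using h)
    exact ⟨this 0, this 1, this 2⟩
  have hcube : ∀ d : F, d ^ 3 ≠ α := by
    intro d hd
    have h : (x - algebraMap F L d) *
        (x ^ 2 + algebraMap F L d * x + algebraMap F L d ^ 2) = 0 := by
      have : x ^ 3 = algebraMap F L d ^ 3 := by rw [hx, ← hd, map_pow]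
      linear_combination this
    rcases mul_eq_zero.1 h with h | h
    · have := key (-d) 1 0 (by simp only [map_neg, map_one, map_zero]; linear_combination h)
      exact one_ne_zero this.2.1
    · have := key (d ^ 2) d 1 (by simp only [map_pow, map_one]; linear_combination h)
      exact one_ne_zero this.2.2
  have hy0 : y ≠ 0 := by
    rintro rfl
    apply hβ
    apply (algebraMap F L).injective
    rw [← hy]; simp
  obtain ⟨a, b, c, rfl⟩ := hsp y
  have h3 := key (a ^ 3 + α * b ^ 3 + α ^ 2 * c ^ 3 + 6 * α * a * b * c - β)
    (3 * (a ^ 2 * b + α * b ^ 2 * c + α * a * c ^ 2))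
    (3 * (a ^ 2 * c + a * b ^ 2 + α * b * c ^ 2)) (by
      simp only [map_add, map_sub, map_mul, map_pow, map_ofNat, ← hx, ← hy]
      ring)
  obtain ⟨-, e1, e2⟩ := h3
  replace e1 := (mul_eq_zero.1 e1).resolve_left hchar
  replace e2 := (mul_eq_zero.1 e2).resolve_left hchar
  have e3 : a * (α * c ^ 3 - b ^ 3) = 0 := by linear_combination c * e1 - b * e2
  rcases mul_eq_zero.1 e3 with rfl | e
  · have e4 : α * (b ^ 2 * c) = 0 := by linear_combination e1
    have e5 := (mul_eq_zero.1 e4).resolve_left hα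
    rcases mul_eq_zero.1 e5 with hb | rfl
    · have hb : b = 0 := by simpa using hb
      subst hb
      refine ⟨c, ?_, Or.inr (Or.inr (by simp))⟩
      rintro rfl
      simp at hy0
    · refine ⟨b, ?_, Or.inr (Or.inl (by simp))⟩
      rintro rfl
      simp at hy0
  · have hc : c = 0 := by
      by_contra hc
      apply hcube (b / c)
      field_simp
      linear_combination -e
    subst hc
    have hb : b = 0 := by simpa using e
    subst hb
    refine ⟨a, ?_, Or.inl (by simp)⟩
    rintro rfl
    simp at hy0
end

section
/- With Λ, B, k, ℓ, e₁,…,e₆ as below, let b be the automorphism of Λ fixing ℓ, e₁, e₂, e₃ and sending e₄ ↦ e₅ ↦ e₆ ↦ e₄, and let c be the automorphism fixing ℓ, e₄, e₅, e₆ and sending e₁ ↦ e₂ ↦ e₃ ↦ e₁ (both lie in W(E₆)). Set q₁ = 2ℓ − e₂ − e₃ − e₄ − e₅ − e₆, q₂ = 2ℓ − e₁ − e₃ − e₄ − e₅ − e₆, q₃ = 2ℓ − e₁ − e₂ − e₄ − e₅ − e₆, and ℓᵢⱼ = ℓ − eᵢ − eⱼ. Then there exists r ∈ W(E₆) with r(e₁)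 = q₁, r(e₂) = q₂, r(e₃) = q₃, r(e₄) = ℓ₅₆, r(e₅) = ℓ₄₆, r(e₆) = ℓ₄₅; this r has order 3, commutes with both b and c, and the subgroup of W(E₆) generated by r, b, c is isomorphic to (ℤ/3ℤ)³. -/
/-- The Picard lattice `Λ = ℤℓ ⊕ ℤe₁ ⊕ ⋯ ⊕ ℤe₆ ≅ ℤ⁷` of a smooth cubic surface;
coordinate `0` corresponds to `ℓ`, coordinates `1,…,6` to `e₁,…,e₆`. -/
abbrev PicLat : Type := Fin 7 → ℤ

/-- The class `ℓ` of a line (pullback of a line under the blow-down to the plane). -/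
def lvec : PicLat := Pi.single 0 1

/-- The classes `e₁, …, e₆` of the six exceptional lines: `evec i` is `e_{i+1}`. -/
def evec (i : Fin 6) : PicLat := Pi.single i.succ 1

/-- The canonical class `k = -3ℓ + e₁ + ⋯ + e₆`. -/
def kvec : PicLat := fun j => if j = 0 then -3 else 1

/-- The intersection form: `B(ℓ,ℓ) = 1`, `B(eᵢ,eᵢ) = -1`, all other products of basis
vectors zero. -/
def Bform (x y : PicLat) : ℤ := x 0 * y 0 - ∑ i : Fin 6, x i.succ * y i.succ

/-- Membership in the Weyl group `W(E₆)`: a `ℤ`-linear automorphism of `Λ` preserving the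
intersection form `B` and fixing the canonical class `k`. -/
def IsWE6 (g : PicLat ≃ₗ[ℤ] PicLat) : Prop :=
  (∀ x y : PicLat, Bform (g x) (g y) = Bform x y) ∧ g kvec = kvec

/-- `q₁ = 2ℓ − e₂ − e₃ − e₄ − e₅ − e₆`. -/
def q1 : PicLat := 2 • lvec - evec 1 - evec 2 - evec 3 - evec 4 - evec 5
/-- `q₂ = 2ℓ − e₁ − e₃ − e₄ − e₅ − e₆`. -/
def q2 : PicLat := 2 • lvec - evec 0 - evec 2 - evec 3 - evec 4 - evec 5
/-- `q₃ = 2ℓ − e₁ − e₂ − e₄ − e₅ − e₆`. -/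
def q3 : PicLat := 2 • lvec - evec 0 - evec 1 - evec 3 - evec 4 - evec 5
/-- `ℓ₅₆ = ℓ − e₅ − e₆`. -/
def l56 : PicLat := lvec - evec 4 - evec 5
/-- `ℓ₄₆ = ℓ − e₄ − e₆`. -/
def l46 : PicLat := lvec - evec 3 - evec 5
/-- `ℓ₄₅ = ℓ − e₄ − e₅`. -/
def l45 : PicLat := lvec - evec 3 - evec 4

/-- Coordinate expansion of a lattice vector. -/
theorem pic_expand (x : PicLat) : x = x 0 • lvec + x 1 • evec 0 + x 2 • evec 1 + x 3 • evec 2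
    + x 4 • evec 3 + x 5 • evec 4 + x 6 • evec 5 := by
  funext j
  fin_cases j <;> simp [lvec, evec, Pi.single_apply, Fin.ext_iff]

/-- The coordinate formula for `r`. -/
def rfun (x : PicLat) : PicLat :=
  ![4 * x 0 + 2 * x 1 + 2 * x 2 + 2 * x 3 + x 4 + x 5 + x 6,
    -x 0 - x 2 - x 3,
    -x 0 - x 1 - x 3,
    -x 0 - x 1 - x 2,
    -2 * x 0 - x 1 - x 2 - x 3 - x 5 - x 6,
    -2 * x 0 - x 1 - x 2 - x 3 - x 4 - x 6,
    -2 * x 0 - x 1 - x 2 - x 3 - x 4 - x 5]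

theorem rfun_cube (x : PicLat) : rfun (rfun (rfun x)) = x := by
  funext j
  fin_cases j <;> simp [rfun] <;> ring

/-- The automorphism `r`. -/
def rEquiv : PicLat ≃ₗ[ℤ] PicLat where
  toFun := rfun
  invFun x := rfun (rfun x)
  left_inv := rfun_cube
  right_inv := rfun_cube
  map_add' x y := by
    funext j
    fin_cases j <;> simp [rfun] <;> ring
  map_smul' a x := by
    funext j
    fin_cases j <;> simp [rfun] <;> ring

theorem rEquiv_apply (x : PicLat) : rEquiv x = rfun x := rfl

/-- Three commuting elements of exponent three which are independent generate `(ℤ/3)³`. -/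
theorem closure_three {G : Type*} [Group G] (r b c : G) (hr : r ^ 3 = 1) (hb : b ^ 3 = 1)
    (hc : c ^ 3 = 1) (hrb : Commute r b) (hrc : Commute r c) (hbc : Commute b c)
    (hind : ∀ i j k : ℕ, i < 3 → j < 3 → k < 3 → r ^ i * (b ^ j * c ^ k) = 1 →
      i = 0 ∧ j = 0 ∧ k = 0) :
    Nonempty ((Subgroup.closure {r, b, c} : Subgroup G) ≃*
      (Multiplicative (ZMod 3) × Multiplicative (ZMod 3) × Multiplicative (ZMod 3))) := by
  have key : ∀ g : G, g ^ 3 = 1 → ∀ x y : ZMod 3, g ^ (x + y).val = g ^ x.val * g ^ y.val := by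
    intro g hg x y
    rw [← pow_add, ZMod.val_add, ← pow_eq_pow_mod _ hg]
  let f : (Multiplicative (ZMod 3) × Multiplicative (ZMod 3) × Multiplicative (ZMod 3)) →* G :=
    { toFun := fun x => r ^ (x.1.toAdd).val * (b ^ (x.2.1.toAdd).val * c ^ (x.2.2.toAdd).val)
      map_one' := by simp
      map_mul' := by
        rintro ⟨i, j, k⟩ ⟨i', j', k'⟩
        simp only [Prod.mk_mul_mk, toAdd_mul, key r hr, key b hb, key c hc]
        generalize i.toAdd.val = i, j.toAdd.val = j, k.toAdd.val = k,
          i'.toAdd.val = i', j'.toAdd.val = j', k'.toAdd.val = k'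
        have h1 : Commute (b ^ j * c ^ k) (r ^ i') :=
          ((hrb.pow_pow i' j).mul_right (hrc.pow_pow i' k)).symm
        have h2 : Commute (c ^ k) (b ^ j') := (hbc.pow_pow j' k).symm
        rw [h1.mul_mul_mul_comm, h2.mul_mul_mul_comm] }
  have hf : ∀ x, f x = r ^ (x.1.toAdd).val * (b ^ (x.2.1.toAdd).val * c ^ (x.2.2.toAdd).val) :=
    fun _ => rfl
  have hinj : Function.Injective f := by
    rw [injective_iff_map_eq_one]
    rintro ⟨i, j, k⟩ h
    rw [hf] at h
    obtain ⟨h1, h2, h3⟩ := hind _ _ _ (ZMod.val_lt _) (ZMod.val_lt _) (ZMod.val_lt _) h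
    rw [ZMod.val_eq_zero] at h1 h2 h3
    exact Prod.ext h1 (Prod.ext h2 h3)
  have hv : (1 : ZMod 3).val = 1 := rfl
  have hrange : f.range = Subgroup.closure {r, b, c} := by
    apply le_antisymm
    · rintro _ ⟨x, rfl⟩
      rw [hf]
      have hm : ∀ g ∈ ({r, b, c} : Set G), ∀ n : ℕ, g ^ n ∈ Subgroup.closure {r, b, c} :=
        fun g hg n => pow_mem (Subgroup.subset_closure hg) n
      exact mul_mem (hm r (by simp) _) (mul_mem (hm b (by simp) _) (hm c (by simp) _))
    · rw [Subgroup.closure_le]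
      rintro g (rfl | rfl | rfl)
      · exact ⟨(Multiplicative.ofAdd 1, 1, 1), by rw [hf]; simp [hv]⟩
      · exact ⟨(1, Multiplicative.ofAdd 1, 1), by rw [hf]; simp [hv]⟩
      · exact ⟨(1, 1, Multiplicative.ofAdd 1), by rw [hf]; simp [hv]⟩
  exact ⟨((MonoidHom.ofInjective hinj).trans (MulEquiv.subgroupCongr hrange)).symm⟩

/-- Let `b ∈ W(E₆)` fix `ℓ, e₁, e₂, e₃` and send `e₄ ↦ e₅ ↦ e₆ ↦ e₄`, and let `c ∈ W(E₆)`
fix `ℓ, e₄, e₅, e₆` and send `e₁ ↦ e₂ ↦ e₃ ↦ e₁`. Then there is `r ∈ W(E₆)` with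
`r(eᵢ) = qᵢ` for `i = 1,2,3` and `r(e₄) = ℓ₅₆`, `r(e₅) = ℓ₄₆`, `r(e₆) = ℓ₄₅`; this `r` has
order `3`, commutes with `b` and `c`, and `⟨r, b, c⟩ ≅ (ℤ/3ℤ)³`. -/
theorem stmt_9 (b c : PicLat ≃ₗ[ℤ] PicLat) (hbW : IsWE6 b) (hcW : IsWE6 c)
    (hbl : b lvec = lvec)
    (hb1 : b (evec 0) = evec 0) (hb2 : b (evec 1) = evec 1) (hb3 : b (evec 2) = evec 2)
    (hb4 : b (evec 3) = evec 4) (hb5 : b (evec 4) = evec 5) (hb6 : b (evec 5) = evec 3)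
    (hcl : c lvec = lvec)
    (hc4 : c (evec 3) = evec 3) (hc5 : c (evec 4) = evec 4) (hc6 : c (evec 5) = evec 5)
    (hc1 : c (evec 0) = evec 1) (hc2 : c (evec 1) = evec 2) (hc3 : c (evec 2) = evec 0) :
    ∃ r : PicLat ≃ₗ[ℤ] PicLat, IsWE6 r ∧
      r (evec 0) = q1 ∧ r (evec 1) = q2 ∧ r (evec 2) = q3 ∧
      r (evec 3) = l56 ∧ r (evec 4) = l46 ∧ r (evec 5) = l45 ∧
      orderOf r = 3 ∧ r * b = b * r ∧ r * c = c * r ∧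
      Nonempty ((Subgroup.closure {r, b, c} : Subgroup (PicLat ≃ₗ[ℤ] PicLat)) ≃*
        (Multiplicative (ZMod 3) × Multiplicative (ZMod 3) × Multiplicative (ZMod 3))) := by
  have hb : ∀ x : PicLat, b x = ![x 0, x 1, x 2, x 3, x 6, x 4, x 5] := by
    intro x
    conv_lhs => rw [pic_expand x]
    simp only [map_add, map_smul, hbl, hb1, hb2, hb3, hb4, hb5, hb6]
    funext j
    fin_cases j <;> simp [lvec, evec, Pi.single_apply, Fin.ext_iff]
  have hc : ∀ x : PicLat, c x = ![x 0, x 3, x 1, x 2, x 4, x 5, x 6] := by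
    intro x
    conv_lhs => rw [pic_expand x]
    simp only [map_add, map_smul, hcl, hc1, hc2, hc3, hc4, hc5, hc6]
    funext j
    fin_cases j <;> simp [lvec, evec, Pi.single_apply, Fin.ext_iff]
  have hr3 : rEquiv ^ 3 = 1 := by
    ext1 x
    simpa [pow_succ, rEquiv_apply] using rfun_cube x
  have hb3' : b ^ 3 = 1 := by
    ext x j
    fin_cases j <;> simp [pow_succ, hb]
  have hc3' : c ^ 3 = 1 := by
    ext x j
    fin_cases j <;> simp [pow_succ, hc]
  have hrb : rEquiv * b = b * rEquiv := by
    apply LinearEquiv.ext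
    intro x
    funext j
    fin_cases j <;> simp [hb, rEquiv_apply, rfun] <;> ring
  have hrc : rEquiv * c = c * rEquiv := by
    apply LinearEquiv.ext
    intro x
    funext j
    fin_cases j <;> simp [hc, rEquiv_apply, rfun] <;> ring
  have hbc : b * c = c * b := by
    apply LinearEquiv.ext
    intro x
    funext j
    fin_cases j <;> simp [hb, hc]
  have hr0 : rEquiv (evec 0) = q1 := by
    rw [rEquiv_apply]; decide
  refine ⟨rEquiv, ⟨?_, ?_⟩, hr0, ?_, ?_, ?_, ?_, ?_, ?_, hrb, hrc, ?_⟩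
  · intro x y
    simp [Bform, rEquiv_apply, rfun, Fin.sum_univ_succ]
    ring
  · rw [rEquiv_apply]; decide
  · rw [rEquiv_apply]; decide
  · rw [rEquiv_apply]; decide
  · rw [rEquiv_apply]; decide
  · rw [rEquiv_apply]; decide
  · rw [rEquiv_apply]; decide
  · have : Fact (Nat.Prime 3) := ⟨Nat.prime_three⟩
    refine orderOf_eq_prime hr3 ?_
    intro h
    rw [h] at hr0
    exact absurd hr0 (by decide)
  · refine closure_three _ _ _ hr3 hb3' hc3' hrb hrc hbc ?_
    intro i j k hi hj hk h
    have hA : ∀ x m, (rEquiv ^ i * (b ^ j * c ^ k)) x m = x m := by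
      intro x m
      rw [h]; rfl
    have h1 := hA ![0, 1, 0, 0, 0, 0, 0] 0
    have h2 := hA ![0, 0, 0, 0, 1, 0, 0] 4
    have h3 := hA ![0, 1, 0, 0, 0, 0, 0] 1
    clear hA h
    interval_cases i <;> interval_cases j <;> interval_cases k <;>
      simp [pow_succ, hb, hc, rEquiv_apply, rfun] at h1 h2 h3 ⊢
end

section
/- With Λ, B, k, ℓ, e₁,…,e₆ as below, set q₁ = 2ℓ − e₂ − e₃ − e₄ − e₅ − e₆, q₂ = 2ℓ − e₁ − e₃ − e₄ − e₅ − e₆, q₃ = 2ℓ − e₁ − e₂ − e₄ − e₅ − e₆, and ℓᵢⱼ = ℓ − eᵢ − eⱼ, and let r ∈ W(E₆) be the element with r(e₁) = q₁, r(e₂) = q₂, r(e₃) = q₃, r(e₄) = ℓ₅₆, r(e₅) = ℓ₄₆, r(e₆) = ℓ₄₅. Then every g ∈ W(E₆) that maps the set {e₁, e₂, e₃} onto itself and maps the set {e₄, e₅, e₆} onto itself commutes with r. -/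
/-- A linear map permuting a finite set fixes the sum of its elements. -/
lemma sum_fixed (g : PicLat ≃ₗ[ℤ] PicLat) (a b c : PicLat)
    (hab : a ≠ b) (hac : a ≠ c) (hbc : b ≠ c)
    (h : (⇑g) '' {a, b, c} = {a, b, c}) : g (a + b + c) = a + b + c := by
  classical
  have hs : ∑ x ∈ ({a, b, c} : Finset PicLat), x = a + b + c := by
    rw [Finset.sum_insert (by simp [hab, hac]), Finset.sum_insert (by simp [hbc]),
      Finset.sum_singleton, add_assoc]
  have hi : ({a, b, c} : Finset PicLat).image g = {a, b, c} := by
    apply Finset.coe_injective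
    rw [Finset.coe_image]
    simpa only [Finset.coe_insert, Finset.coe_singleton] using h
  rw [← hs, map_sum]
  conv_rhs => rw [← hi]
  rw [Finset.sum_image (fun x _ y _ hxy => g.injective hxy)]

lemma evec_ne {i j : Fin 6} (h : i ≠ j) : evec i ≠ evec j := by
  intro he
  have := congrFun he i.succ
  simp [evec, Pi.single_apply, h] at this

lemma kvec_eq : kvec = -3 • lvec + (evec 0 + evec 1 + evec 2) + (evec 3 + evec 4 + evec 5) := by
  funext j
  fin_cases j <;> simp [kvec, lvec, evec, Pi.single_apply, Fin.ext_iff]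

lemma three_cancel {x y : PicLat} (h : (3 : ℤ) • x = (3 : ℤ) • y) : x = y := by
  funext j
  have := congrFun h j
  simp only [Pi.smul_apply, smul_eq_mul] at this
  omega

/-- Let `r ∈ W(E₆)` be the element with `r(eᵢ) = qᵢ` for `i = 1,2,3`, `r(e₄) = ℓ₅₆`,
`r(e₅) = ℓ₄₆`, `r(e₆) = ℓ₄₅`. Then every `g ∈ W(E₆)` mapping the set `{e₁,e₂,e₃}` onto
itself and the set `{e₄,e₅,e₆}` onto itself commutes with `r`. -/
theorem stmt_10 (r : PicLat ≃ₗ[ℤ] PicLat) (hrW : IsWE6 r)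
    (hr1 : r (evec 0) = q1) (hr2 : r (evec 1) = q2) (hr3 : r (evec 2) = q3)
    (hr4 : r (evec 3) = l56) (hr5 : r (evec 4) = l46) (hr6 : r (evec 5) = l45)
    (g : PicLat ≃ₗ[ℤ] PicLat) (hgW : IsWE6 g)
    (hg123 : (⇑g) '' {evec 0, evec 1, evec 2} = {evec 0, evec 1, evec 2})
    (hg456 : (⇑g) '' {evec 3, evec 4, evec 5} = {evec 3, evec 4, evec 5}) :
    g * r = r * g := by
  have hS := sum_fixed g _ _ _ (evec_ne (by decide)) (evec_ne (by decide))
    (evec_ne (by decide)) hg123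
  have hT := sum_fixed g _ _ _ (evec_ne (by decide)) (evec_ne (by decide))
    (evec_ne (by decide)) hg456
  have h3 : (3 : ℤ) • lvec = (evec 0 + evec 1 + evec 2) + (evec 3 + evec 4 + evec 5) - kvec := by
    rw [kvec_eq]; module
  have hgl : g lvec = lvec := by
    apply three_cancel
    rw [← map_smul, h3, map_sub, map_add, hS, hT, hgW.2]
  have hrS : ∀ x ∈ ({evec 0, evec 1, evec 2} : Set PicLat),
      r x = 2 • lvec - (evec 0 + evec 1 + evec 2) - (evec 3 + evec 4 + evec 5) + x := by
    rintro x (rfl | rfl | rfl)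
    · rw [hr1, q1]; abel
    · rw [hr2, q2]; abel
    · rw [hr3, q3]; abel
  have hrT : ∀ x ∈ ({evec 3, evec 4, evec 5} : Set PicLat),
      r x = lvec - (evec 3 + evec 4 + evec 5) + x := by
    rintro x (rfl | rfl | rfl)
    · rw [hr4, l56]; abel
    · rw [hr5, l46]; abel
    · rw [hr6, l45]; abel
  have cS : ∀ x ∈ ({evec 0, evec 1, evec 2} : Set PicLat), g (r x) = r (g x) := by
    intro x hx
    rw [hrS x hx, hrS (g x) (hg123 ▸ Set.mem_image_of_mem g hx), map_add, map_sub, map_sub,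
      hS, hT, map_nsmul, hgl]
  have cT : ∀ x ∈ ({evec 3, evec 4, evec 5} : Set PicLat), g (r x) = r (g x) := by
    intro x hx
    rw [hrT x hx, hrT (g x) (hg456 ▸ Set.mem_image_of_mem g hx), map_add, map_sub, hT, hgl]
  have c0 := cS (evec 0) (by simp)
  have c1 := cS (evec 1) (by simp)
  have c2 := cS (evec 2) (by simp)
  have c3 := cT (evec 3) (by simp)
  have c4 := cT (evec 4) (by simp)
  have c5 := cT (evec 5) (by simp)
  have cl : g (r lvec) = r (g lvec) := by
    apply three_cancel
    rw [← map_smul, ← map_smul, ← map_smul, ← map_smul, h3]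
    simp only [map_sub, map_add, c0, c1, c2, c3, c4, c5, hgW.2, hrW.2]
  apply LinearEquiv.toLinearMap_injective
  apply LinearMap.pi_ext'
  intro i
  apply LinearMap.ext_ring
  change g (r (Pi.single i 1)) = r (g (Pi.single i 1))
  fin_cases i
  · exact cl
  · exact c0
  · exact c1
  · exact c2
  · exact c3
  · exact c4
  · exact c5
end

section
/- With Λ, B, k, ℓ, e₁,…,e₆ as below, let α be a ℚ-linear endomorphism of Λ ⊗ ℚ such that α(k) = k and such that for each i = 1,…,6 the vector vᵢ := α(eᵢ) lies in Λ and satisfies B(vᵢ, vᵢ) = −1, B(vᵢ, k) = −1, and B(vᵢ, vⱼ) = 0 for all i ≠ j. Then α is a ℚ-linear automorphism of Λ ⊗ ℚ which restricts to a ℤ-linear automorphism of Λ preserving the bilinear form B; in particular α ∈ W(E₆). -/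
/-- The rational Picard lattice `Λ ⊗ ℚ ≅ ℚ⁷`. -/
abbrev QPicLat : Type := Fin 7 → ℚ

/-- The natural inclusion `Λ → Λ ⊗ ℚ`. -/
def iota (x : PicLat) : QPicLat := fun i => (x i : ℚ)

lemma Bform_comm' (x y : PicLat) : Bform x y = Bform y x := by
  simp only [Bform, mul_comm]

lemma Bform_add_left' (x y z : PicLat) : Bform (x + y) z = Bform x z + Bform y z := by
  simp only [Bform, Fin.sum_univ_succ, Pi.add_apply]; ring

lemma Bform_sub_left' (x y z : PicLat) : Bform (x - y) z = Bform x z - Bform y z := by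
  simp only [Bform, Fin.sum_univ_succ, Pi.sub_apply]; ring

lemma Bform_add_right' (x y z : PicLat) : Bform x (y + z) = Bform x y + Bform x z := by
  simp only [Bform, Fin.sum_univ_succ, Pi.add_apply]; ring

lemma Bform_sub_right' (x y z : PicLat) : Bform x (y - z) = Bform x y - Bform x z := by
  simp only [Bform, Fin.sum_univ_succ, Pi.sub_apply]; ring

/-- The diagonal Gram matrix of the intersection form. -/
def Dmat (R : Type) [CommRing R] : Matrix (Fin 7) (Fin 7) R :=
  Matrix.diagonal (Fin.cons 1 (fun _ => -1))

lemma Dmat_sq (R : Type) [CommRing R] : Dmat R * Dmat R = 1 := by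
  rw [Dmat, Matrix.diagonal_mul_diagonal, ← Matrix.diagonal_one]
  congr 1
  ext i
  refine Fin.cases ?_ (fun j => ?_) i <;> simp

lemma MDM_apply (R : Type) [CommRing R] (M : Matrix (Fin 7) (Fin 7) R) (a b : Fin 7) :
    (M * Dmat R * M.transpose) a b = M a 0 * M b 0 - ∑ i : Fin 6, M a i.succ * M b i.succ := by
  rw [Dmat, Matrix.mul_apply, Fin.sum_univ_succ]
  simp [Matrix.mul_diagonal, sub_eq_add_neg]

lemma inv_of_orth (R : Type) [CommRing R] (M : Matrix (Fin 7) (Fin 7) R)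
    (h : M * Dmat R * M.transpose = Dmat R) :
    (Dmat R * M.transpose * Dmat R) * M = 1 := by
  apply mul_eq_one_comm.mp
  rw [← mul_assoc, ← mul_assoc, h, Dmat_sq]

lemma orth_transpose (R : Type) [CommRing R] (M : Matrix (Fin 7) (Fin 7) R)
    (h : M * Dmat R * M.transpose = Dmat R) :
    M.transpose * Dmat R * M = Dmat R := by
  have h1 := inv_of_orth R M h
  calc M.transpose * Dmat R * M
      = (Dmat R * Dmat R) * (M.transpose * Dmat R * M) := by rw [Dmat_sq, one_mul]
    _ = Dmat R * ((Dmat R * M.transpose * Dmat R) * M) := by simp only [mul_assoc]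
    _ = Dmat R := by rw [h1, mul_one]

/-- A vector of square `9` orthogonal to six orthogonal `(-1)`-vectors is divisible by 3. -/
lemma div_three (v : Fin 6 → PicLat) (w : PicLat)
    (hvv : ∀ i, Bform (v i) (v i) = -1)
    (hortho : ∀ i j, i ≠ j → Bform (v i) (v j) = 0)
    (hw : ∀ i, Bform w (v i) = 0) (hww : Bform w w = 9) (j : Fin 7) : (3 : ℤ) ∣ w j := by
  let M : Matrix (Fin 7) (Fin 7) ℚ :=
    Matrix.of (Fin.cons (fun j => (w j : ℚ) / 3) (fun i j => (v i j : ℚ)))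
  have M0 : ∀ j, M 0 j = (w j : ℚ) / 3 := fun j => rfl
  have MS : ∀ i j, M (Fin.succ i) j = (v i j : ℚ) := fun i j => rfl
  have hM : M * Dmat ℚ * M.transpose = Dmat ℚ := by
    ext a b
    rw [MDM_apply]
    refine Fin.cases ?_ (fun a => ?_) a <;> refine Fin.cases ?_ (fun b => ?_) b
    · have h : ((Bform w w : ℤ) : ℚ) = 9 := by rw [hww]; norm_num
      simp only [Bform, Fin.sum_univ_succ] at h
      push_cast at h
      simp only [M0, Fin.sum_univ_succ, Dmat, Matrix.diagonal_apply_eq, Fin.cons_zero]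
      push_cast
      linear_combination h / 9
    · have h : ((Bform w (v b) : ℤ) : ℚ) = 0 := by rw [hw]; norm_num
      simp only [Bform, Fin.sum_univ_succ] at h
      push_cast at h
      rw [Dmat, Matrix.diagonal_apply_ne _ (Fin.succ_ne_zero b).symm]
      simp only [M0, MS, Fin.sum_univ_succ]
      push_cast
      linear_combination h / 3
    · have h : ((Bform w (v a) : ℤ) : ℚ) = 0 := by rw [hw]; norm_num
      simp only [Bform, Fin.sum_univ_succ] at h
      push_cast at h
      rw [Dmat, Matrix.diagonal_apply_ne _ (Fin.succ_ne_zero a)]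
      simp only [M0, MS, Fin.sum_univ_succ]
      push_cast
      linear_combination h / 3
    · simp only [MS]
      have h : (v a 0 : ℚ) * v b 0 - ∑ i : Fin 6, (v a i.succ : ℚ) * v b i.succ
          = ((Bform (v a) (v b) : ℤ) : ℚ) := by simp [Bform]
      rw [h]
      by_cases hab : a = b
      · subst hab; rw [hvv]; simp [Dmat]
      · rw [hortho a b hab, Dmat,
          Matrix.diagonal_apply_ne _ (fun h => hab (Fin.succ_injective _ h))]; simp
  have hT := orth_transpose ℚ M hM
  have hj := MDM_apply ℚ M.transpose j j
  rw [Matrix.transpose_transpose, hT] at hj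
  simp only [Matrix.transpose_apply, M0, MS] at hj
  obtain ⟨c, hc⟩ : ∃ c : ℤ, Dmat ℚ j j = (c : ℚ) := by
    refine Fin.cases ⟨1, ?_⟩ (fun i => ⟨-1, ?_⟩) j <;> simp [Dmat]
  rw [hc] at hj
  have h9 : (w j : ℚ) * w j = ((9 * (c + ∑ i, v i j * v i j) : ℤ) : ℚ) := by
    push_cast
    linear_combination -9 * hj
  have h9' : w j * w j = 9 * (c + ∑ i, v i j * v i j) := by exact_mod_cast h9
  have : (3 : ℤ) ∣ w j * w j := ⟨3 * (c + ∑ i, v i j * v i j), by rw [h9']; ring⟩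
  rcases Int.prime_three.dvd_or_dvd this with h | h <;> exact h

/-- Let `α` be a `ℚ`-linear endomorphism of `Λ ⊗ ℚ` fixing `k` and sending each `eᵢ` to a
lattice vector `vᵢ ∈ Λ` with `B(vᵢ,vᵢ) = -1`, `B(vᵢ,k) = -1` and `B(vᵢ,vⱼ) = 0` for `i ≠ j`.
Then `α` is an automorphism of `Λ ⊗ ℚ` restricting to a `ℤ`-linear automorphism of `Λ`
preserving `B`; in particular it lies in `W(E₆)`. -/
theorem stmt_11 (α : QPicLat →ₗ[ℚ] QPicLat)
    (hk : α (iota kvec) = iota kvec)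
    (v : Fin 6 → PicLat)
    (hv : ∀ i, α (iota (evec i)) = iota (v i))
    (hvv : ∀ i, Bform (v i) (v i) = -1)
    (hvk : ∀ i, Bform (v i) kvec = -1)
    (hortho : ∀ i j, i ≠ j → Bform (v i) (v j) = 0) :
    Function.Bijective α ∧
      ∃ β : PicLat ≃ₗ[ℤ] PicLat,
        (∀ x : PicLat, α (iota x) = iota (β x)) ∧
        (∀ x y : PicLat, Bform (β x) (β y) = Bform x y) ∧
        β kvec = kvec := by
  let w : PicLat := v 0 + v 1 + v 2 + v 3 + v 4 + v 5 - kvec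
  have hkk : Bform kvec kvec = 3 := by decide
  have hkv : ∀ i, Bform kvec (v i) = -1 := fun i => by rw [Bform_comm', hvk]
  have hw : ∀ i, Bform w (v i) = 0 := by
    intro i
    simp only [w, Bform_add_left', Bform_sub_left', hkv]
    fin_cases i <;> simp [hvv, hortho]
  have hww : Bform w w = 9 := by
    have h1 : Bform w w = Bform w (v 0 + v 1 + v 2 + v 3 + v 4 + v 5 - kvec) := rfl
    rw [h1]
    simp only [Bform_add_right', Bform_sub_right', hw]
    simp only [w, Bform_add_left', Bform_sub_left', hvk, hkk]
    norm_num
  choose u hu using div_three v w hvv hortho hw hww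
  have huv : ∀ i, Bform u (v i) = 0 := by
    intro i
    have h := hw i
    simp only [Bform, hu, Fin.sum_univ_six] at h ⊢
    linarith
  have huu : Bform u u = 1 := by
    have h := hww
    simp only [Bform, hu, Fin.sum_univ_six] at h ⊢
    linarith
  let N : Matrix (Fin 7) (Fin 7) ℤ := Matrix.of (Fin.cons u v)
  have hNB : ∀ a b, (N * Dmat ℤ * N.transpose) a b = Bform (N a) (N b) := fun a b => by
    rw [MDM_apply]; rfl
  have N0 : N 0 = u := rfl
  have NS : ∀ i : Fin 6, N i.succ = v i := fun i => rfl
  have hN : N * Dmat ℤ * N.transpose = Dmat ℤ := by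
    ext a b
    rw [hNB]
    refine Fin.cases ?_ (fun a => ?_) a <;> refine Fin.cases ?_ (fun b => ?_) b
    · rw [N0, huu]; simp [Dmat]
    · rw [N0, NS, huv, Dmat, Matrix.diagonal_apply_ne _ (Fin.succ_ne_zero b).symm]
    · rw [N0, NS, Bform_comm', huv, Dmat, Matrix.diagonal_apply_ne _ (Fin.succ_ne_zero a)]
    · rw [NS, NS]
      by_cases hab : a = b
      · subst hab; rw [hvv]; simp [Dmat]
      · rw [hortho a b hab, Dmat,
          Matrix.diagonal_apply_ne _ (fun h => hab (Fin.succ_injective _ h))]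
  have hinv := inv_of_orth ℤ N hN
  have hinv1 : N.transpose * (Dmat ℤ * N.transpose * Dmat ℤ).transpose = 1 := by
    rw [← Matrix.transpose_mul, hinv, Matrix.transpose_one]
  have hinv2 := mul_eq_one_comm.mp hinv1
  let β : PicLat ≃ₗ[ℤ] PicLat := Matrix.toLin'OfInv hinv2 hinv1
  have hβ : ∀ x, β x = N.transpose.mulVec x := fun x => Matrix.toLin'_apply N.transpose x
  have hβj : ∀ x j, β x j = x 0 * u j + ∑ i : Fin 6, x i.succ * v i j := by
    intro x j
    rw [hβ, Matrix.mulVec, dotProduct, Fin.sum_univ_succ]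
    simp only [Matrix.transpose_apply, N0, NS, mul_comm]
  have hαl : α (iota lvec) = iota u := by
    have h1 : iota kvec = (-3 : ℚ) • iota lvec + ∑ i, iota (evec i) := by
      ext j
      fin_cases j <;> simp [iota, kvec, lvec, evec, Fin.sum_univ_succ, Pi.single_apply, Fin.ext_iff]
    have h2 := hk
    rw [h1, map_add, map_smul, map_sum, ← h1] at h2
    simp only [hv] at h2
    ext j
    have h3 := congrFun h2 j
    have h4 : ((w j : ℤ) : ℚ) = ((3 * u j : ℤ) : ℚ) := by rw [hu]
    simp only [w, Pi.add_apply, Pi.sub_apply] at h4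
    push_cast at h4
    simp [Fin.sum_univ_six, iota] at h3
    simp only [iota]
    linarith
  have hαβ : ∀ x : PicLat, α (iota x) = iota (β x) := by
    intro x
    have h1 : iota x = (x 0 : ℚ) • iota lvec + ∑ i : Fin 6, (x i.succ : ℚ) • iota (evec i) := by
      ext j
      fin_cases j <;> simp [iota, lvec, evec, Fin.sum_univ_succ, Pi.single_apply, Fin.ext_iff] <;> rfl
    rw [h1, map_add, map_smul, map_sum]
    simp only [map_smul, hv, hαl]
    ext j
    simp [iota, hβj]
  have hiota : Function.Injective iota := by
    intro x y h
    ext j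
    have := congrFun h j
    simpa [iota] using this
  have hsurj : Function.Surjective α := by
    rw [← LinearMap.range_eq_top, eq_top_iff, ← (Pi.basisFun ℚ (Fin 7)).span_eq,
      Submodule.span_le]
    rintro _ ⟨j, rfl⟩
    refine ⟨iota (β.symm (Pi.single j 1)), ?_⟩
    rw [hαβ, LinearEquiv.apply_symm_apply]
    ext i
    simp [iota, Pi.single_apply]
  refine ⟨⟨LinearMap.injective_iff_surjective.mpr hsurj, hsurj⟩, β, hαβ, ?_, ?_⟩
  · have hB : ∀ x y, Bform x y = dotProduct x ((Dmat ℤ).mulVec y) := by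
      intro x y
      rw [dotProduct, Fin.sum_univ_succ]
      simp [Dmat, Bform, Matrix.mulVec_diagonal, sub_eq_add_neg]
    intro x y
    rw [hB, hB, hβ, hβ, Matrix.mulVec_transpose, ← Matrix.dotProduct_mulVec,
      Matrix.mulVec_mulVec, Matrix.mulVec_mulVec, hN]
  · apply hiota
    rw [← hαβ, hk]
end

section
/- Let F be an algebraically closed field. Let f be a homogeneous polynomial of degree 3 in four variables over F whose projective zero locus is a smooth cubic surface, i.e., there is no nonzero v ∈ F⁴ with f(v) = 0 at which all four partial derivatives of f vanish. Let W₁,…,W₆ be 2-dimensional F-linear subspaces of F⁴ such that Wᵢ ∩ Wⱼ = {0} for i ≠ j and f vanishes identically on each Wᵢ (six pairwise skew lines on the cubic surface). If θ ∈ GL₄(F) satisfies θ(Wᵢ) = Wᵢ for all i = 1,…,6, then θ is a scalar matrix. -/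
open MvPolynomial

section helpers

theorem finsupp_peel (d : Fin 4 →₀ ℕ) (n : ℕ) (h : d.degree = n + 1) :
    ∃ i d', d = Finsupp.single i 1 + d' ∧ Finsupp.degree d' = n := by
  have hd : d ≠ 0 := by
    rintro rfl
    simp at h
  obtain ⟨i, hi⟩ := Finsupp.ne_iff.1 hd
  have hi' : Finsupp.single i 1 ≤ d := by
    rw [Finsupp.single_le_iff]
    simp at hi
    omega
  refine ⟨i, d - Finsupp.single i 1, (add_tsub_cancel_of_le hi').symm, ?_⟩
  have := congrArg Finsupp.degree (add_tsub_cancel_of_le hi')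
  rw [map_add, Finsupp.degree_single] at this
  omega

/-- A homogeneous cubic is the diagonal of a (not nec. symmetric) trilinear form. -/
theorem cubic_trilinear {F : Type*} [Field F] (f : MvPolynomial (Fin 4) F)
    (hf : f.IsHomogeneous 3) :
    ∃ T : (Fin 4 → F) →ₗ[F] (Fin 4 → F) →ₗ[F] (Fin 4 → F) →ₗ[F] F,
      (∀ v, eval v f = T v v v) ∧
      (∀ v i, eval v (pderiv i f) =
        T (Pi.single i 1) v v + T v (Pi.single i 1) v + T v v (Pi.single i 1)) := by
  have key : ∀ s : Finset (Fin 4 →₀ ℕ), (∀ d ∈ s, Finsupp.degree d = 3) →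
    ∃ T : (Fin 4 → F) →ₗ[F] (Fin 4 → F) →ₗ[F] (Fin 4 → F) →ₗ[F] F,
      (∀ v, eval v (∑ d ∈ s, monomial d (f.coeff d)) = T v v v) ∧
      (∀ v i, eval v (pderiv i (∑ d ∈ s, monomial d (f.coeff d))) =
        T (Pi.single i 1) v v + T v (Pi.single i 1) v + T v v (Pi.single i 1)) := by
    intro s
    induction s using Finset.induction_on with
    | empty =>
      intro _
      exact ⟨0, by simp, by simp⟩
    | insert d s hd ih =>
      intro h
      obtain ⟨T, h1, h2⟩ := ih (fun e he => h e (Finset.mem_insert_of_mem he))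
      have h3 := h d (Finset.mem_insert_self _ _)
      obtain ⟨i, d1, e1, h4⟩ := finsupp_peel d 2 h3
      obtain ⟨j, d2, e2, h5⟩ := finsupp_peel d1 1 h4
      obtain ⟨k, d3, e3, h6⟩ := finsupp_peel d2 0 h5
      have h7 : d3 = 0 := (Finsupp.degree_eq_zero_iff d3).1 h6
      have hm : (monomial d (f.coeff d) : MvPolynomial (Fin 4) F)
          = C (f.coeff d) * (X i * (X j * X k)) := by
        generalize f.coeff d = a
        rw [e1, e2, e3, h7, X, X, X, monomial_mul, monomial_mul, C_mul_monomial]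
        simp
      refine ⟨T + (LinearMap.proj i : (Fin 4 → F) →ₗ[F] F).smulRight
        ((LinearMap.proj j : (Fin 4 → F) →ₗ[F] F).smulRight
          (f.coeff d • (LinearMap.proj k : (Fin 4 → F) →ₗ[F] F))), ?_, ?_⟩
      · intro v
        rw [Finset.sum_insert hd, map_add, h1, hm]
        simp
        ring
      · intro v l
        rw [Finset.sum_insert hd, map_add, map_add, h2, hm]
        simp [Derivation.leibniz, pderiv_X, Pi.single_apply, apply_ite (eval v)]
        simp only [eq_comm (b := l)]
        split_ifs <;> simp <;> ring
  obtain ⟨T, h1, h2⟩ := key f.support (fun d hd => by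
    have := hf (mem_support_iff.1 hd)
    rw [Finsupp.degree_eq_weight_one]
    exact this)
  rw [← f.as_sum] at h1 h2
  exact ⟨T, h1, h2⟩

/-- coefficient extraction for binary cubics -/
theorem bincubic {F : Type*} [Field F] [Infinite F] (A B C D : F)
    (h : ∀ s t : F, A * s ^ 3 + B * s ^ 2 * t + C * s * t ^ 2 + D * t ^ 3 = 0) :
    A = 0 ∧ B = 0 ∧ C = 0 ∧ D = 0 := by
  classical
  have hA : A = 0 := by simpa using h 1 0
  have hD : D = 0 := by simpa using h 0 1
  subst hA hD
  obtain ⟨s, hs⟩ := Infinite.exists_notMem_finset ({0, 1} : Finset F)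
  simp at hs
  have h1 := h 1 1
  have h2 := h s 1
  have h3 : B * (s * (s - 1)) = 0 := by linear_combination h2 - s * h1
  have hB : B = 0 := by
    simpa [hs.1, sub_ne_zero.2 hs.2] using h3
  subst hB
  refine ⟨rfl, rfl, ?_, rfl⟩
  simpa using h1

/-- A conic containing a line through a point of the axis has zero half-discriminant. -/
theorem half_disc {F : Type*} [Field F] (a b c d e h x y q r : F) (hxy : x ≠ 0 ∨ y ≠ 0)
    (h1 : a * x ^ 2 + b * x * y + c * y ^ 2 = 0)
    (h2 : 2 * a * q * x + b * (q * y + r * x) + 2 * c * r * y + d * x + e * y = 0)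
    (h3 : a * q ^ 2 + b * q * r + c * r ^ 2 + d * q + e * r + h = 0) :
    4 * a * c * h + b * d * e - a * e ^ 2 - c * d ^ 2 - h * b ^ 2 = 0 := by
  have hh : h = -(a * q ^ 2 + b * q * r + c * r ^ 2 + d * q + e * r) := by
    linear_combination h3
  rcases hxy with hx | hy
  · have ha : a = -(b * (y / x) + c * (y / x) ^ 2) := by
      field_simp
      linear_combination h1
    have hd : d = -(2 * a * q + b * (q * (y / x) + r) + 2 * c * r * (y / x) + e * (y / x)) := by
      field_simp
      linear_combination h2
    generalize y / x = m at *
    subst hh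
    subst hd
    subst ha
    ring
  · have ha : c = -(b * (x / y) + a * (x / y) ^ 2) := by
      field_simp
      linear_combination h1
    have hd : e = -(2 * a * q * (x / y) + b * (q + r * (x / y)) + 2 * c * r + d * (x / y)) := by
      field_simp
      linear_combination h2
    generalize x / y = m at *
    subst hh
    subst hd
    subst ha
    ring

open Polynomial in
theorem quartic_roots {F : Type*} [Field F] (k0 k1 k2 k3 k4 : F) (r : Fin 5 → F)
    (hr : Function.Injective r)
    (h : ∀ i, k4 * r i ^ 4 + k3 * r i ^ 3 + k2 * r i ^ 2 + k1 * r i + k0 = 0) : k4 = 0 := by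
  by_contra hk
  set P : F[X] := Polynomial.C k4 * Polynomial.X ^ 4 + Polynomial.C k3 * Polynomial.X ^ 3
    + Polynomial.C k2 * Polynomial.X ^ 2 + Polynomial.C k1 * Polynomial.X + Polynomial.C k0 with hP
  have hdeg : P.natDegree ≤ 4 := by
    rw [hP]; compute_degree
  have h0 : P = 0 := by
    apply Polynomial.eq_zero_of_natDegree_lt_card_of_eval_eq_zero P hr
    · intro i
      simpa [hP] using h i
    · simp
      omega
  have : P.coeff 4 = k4 := by
    rw [hP]; simp
  rw [h0] at this
  simp at this
  exact hk this.symm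

theorem final_alg {F : Type*} [Field F] [IsAlgClosed F]
    (α β γ a1 b1 c1 d1 d2 e1 e2 h1 h2 h3 : F)
    (hns : ∀ y w : F, (y ≠ 0 ∨ w ≠ 0) → w * (β * y + γ * w) = 0 →
      c1 * y ^ 2 + e1 * y * w + h1 * w ^ 2 ≠ 0)
    (r : Fin 5 → F) (hr : Function.Injective r)
    (hd : ∀ i, ∀ a b c d e h : F, a = α * r i + a1 → b = β * r i + b1 → c = c1 →
      d = γ * r i ^ 2 + d1 * r i + d2 → e = e1 * r i + e2 →
      h = h1 * r i ^ 2 + h2 * r i + h3 →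
      4 * a * c * h + b * d * e - a * e ^ 2 - c * d ^ 2 - h * b ^ 2 = 0) : False := by
  have hlead : β * γ * e1 - c1 * γ ^ 2 - h1 * β ^ 2 = 0 := by
    apply quartic_roots
      (4 * a1 * c1 * h3 + b1 * d2 * e2 - a1 * e2 ^ 2 - c1 * d2 ^ 2 - h3 * b1 ^ 2)
      (4 * c1 * (α * h3 + a1 * h2) + (β * d2 * e2 + b1 * d1 * e2 + b1 * d2 * e1)
        - (α * e2 ^ 2 + 2 * a1 * e1 * e2) - 2 * c1 * d1 * d2 - (h2 * b1 ^ 2 + 2 * h3 * b1 * β))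
      (4 * c1 * (α * h2 + a1 * h1) + (β * d1 * e2 + β * d2 * e1 + b1 * d1 * e1 + b1 * γ * e2)
        - (2 * α * e1 * e2 + a1 * e1 ^ 2) - c1 * (d1 ^ 2 + 2 * γ * d2)
        - (h1 * b1 ^ 2 + 2 * h2 * b1 * β + h3 * β ^ 2))
      (4 * c1 * α * h1 + (β * γ * e2 + β * d1 * e1 + b1 * γ * e1) - α * e1 ^ 2
        - 2 * c1 * γ * d1 - (2 * h1 * b1 * β + h2 * β ^ 2))
      _ r hr
    intro i
    linear_combination hd i _ _ _ _ _ _ rfl rfl rfl rfl rfl rfl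
  by_cases hbg : γ ≠ 0 ∨ -β ≠ 0
  · apply hns γ (-β) hbg
    · ring
    · linear_combination -hlead
  · push Not at hbg
    obtain ⟨hg, hb⟩ := hbg
    have hb : β = 0 := by simpa using hb
    by_cases hc : c1 = 0
    · exact hns 1 0 (by simp) (by simp) (by simp [hc])
    · obtain ⟨y, hy⟩ := IsAlgClosed.exists_root
        (Polynomial.C c1 * Polynomial.X ^ 2 + Polynomial.C e1 * Polynomial.X + Polynomial.C h1)
        (by rw [Polynomial.degree_quadratic hc]; decide)
      exact hns y 1 (by simp) (by simp [hg, hb]) (by simpa using hy)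

/-- The linear algebra part: a nonscalar map fixing the `W i` yields a common transversal. -/
theorem transversal {F V : Type*} [Field F] [IsAlgClosed F] [AddCommGroup V] [Module F V]
    [FiniteDimensional F V] (hV : Module.finrank F V = 4)
    (W : Fin 6 → Submodule F V)
    (hdim : ∀ i, Module.finrank F (W i) = 2)
    (hskew : ∀ i j, i ≠ j → W i ⊓ W j = ⊥)
    (θ : V →ₗ[F] V) (hθ : ∀ i, ∀ w ∈ W i, θ w ∈ W i) :
    (∃ c : F, ∀ v, θ v = c • v) ∨
    ∃ p : Fin 6 → V, (∀ i, p i ∈ W i ∧ p i ≠ 0) ∧ ∀ i, ∃ s t : F, p i = s • p 1 + t • p 0 := by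
  have hsum : ∀ i j, i ≠ j → W i ⊔ W j = ⊤ := by
    intro i j hij
    apply Submodule.eq_top_of_finrank_eq
    have := Submodule.finrank_sup_add_finrank_inf_eq (W i) (W j)
    rw [hskew i j hij, hdim, hdim, finrank_bot] at this
    omega
  have hz : ∀ i j, i ≠ j → ∀ v, v ∈ W i → v ∈ W j → v = 0 := by
    intro i j hij v h1 h2
    have : v ∈ W i ⊓ W j := ⟨h1, h2⟩
    simpa [hskew i j hij] using this
  have hdec : ∀ i j, i ≠ j → ∀ v, ∃ a ∈ W i, ∃ b ∈ W j, a + b = v := by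
    intro i j hij v
    exact Submodule.mem_sup.1 (by rw [hsum i j hij]; trivial)
  -- eigenvector in W 0
  have hnt : Nontrivial (W 0) := by
    apply Module.nontrivial_of_finrank_pos (R := F)
    rw [hdim]; norm_num
  obtain ⟨c, hc⟩ := Module.End.exists_eigenvalue (θ.restrict (hθ 0))
  obtain ⟨u, hu⟩ := hc.exists_hasEigenvector
  have hu0 : (u : V) ≠ 0 := by simpa using hu.2
  have huc : θ u = c • (u : V) := by
    have := congrArg Subtype.val hu.apply_eq_smul
    simpa using this
  -- components of eigenvectors are eigenvectors
  have hcomp : ∀ i j, i ≠ j → ∀ a ∈ W i, ∀ b ∈ W j, θ (a + b) = c • (a + b) →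
      θ a = c • a ∧ θ b = c • b := by
    intro i j hij a ha b hb h
    have e : θ a - c • a = -(θ b - c • b) := by
      rw [map_add, smul_add] at h
      rw [← sub_eq_zero] at h ⊢
      rw [← h]; abel
    have h1 : θ a - c • a ∈ W i := sub_mem (hθ i a ha) ((W i).smul_mem c ha)
    have h2 : θ b - c • b ∈ W j := sub_mem (hθ j b hb) ((W j).smul_mem c hb)
    have h3 : θ a - c • a = 0 := hz i j hij _ h1 (by rw [e]; exact neg_mem h2)
    refine ⟨sub_eq_zero.1 h3, sub_eq_zero.1 ?_⟩
    rw [h3] at e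
    exact neg_eq_zero.1 e.symm
  by_cases hsc : ∃ c : F, ∀ v, θ v = c • v
  · exact Or.inl hsc
  right
  -- third index
  have hthird : ∀ i j : Fin 6, ∃ k, k ≠ i ∧ k ≠ j := by decide
  have hE : ∀ i, ∃ p ∈ W i, p ≠ 0 ∧ θ p = c • p := by
    intro i
    by_cases hi : i = 0
    · subst hi
      exact ⟨u, u.2, hu0, huc⟩
    · obtain ⟨k, hk0, hki⟩ := hthird 0 i
      obtain ⟨a, ha, b, hb, hab⟩ := hdec i k hki.symm u
      refine ⟨a, ha, ?_, (hcomp i k hki.symm a ha b hb (by rw [hab, huc])).1⟩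
      rintro rfl
      apply hu0
      apply hz 0 k hk0.symm _ u.2
      rw [← hab, zero_add]
      exact hb
  -- if W i is contained in eigenspace then so is W j
  have hfull : ∀ i, ¬ ∀ w ∈ W i, θ w = c • w := by
    intro i hi
    apply hsc
    have hall : ∀ j, ∀ w ∈ W j, θ w = c • w := by
      intro j
      by_cases hij : j = i
      · subst hij; exact hi
      obtain ⟨k, hki, hkj⟩ := hthird i j
      have hc1 : IsCompl (W j) (W k) := by
        rw [isCompl_iff, disjoint_iff, codisjoint_iff]
        exact ⟨hskew _ _ hkj.symm, hsum _ _ hkj.symm⟩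
      let φ : W i →ₗ[F] W j := ((W j).projectionOnto (W k) hc1).comp (W i).subtype
      have hinj : Function.Injective φ := by
        rw [injective_iff_map_eq_zero]
        intro x hx
        have : (x : V) ∈ W k := by
          simpa [φ] using hx
        have := hz i k hki.symm _ x.2 this
        simpa using this
      have hsurj : Function.Surjective φ :=
        (LinearMap.injective_iff_surjective_of_finrank_eq_finrank
          (by rw [hdim, hdim])).1 hinj
      intro w hw
      obtain ⟨x, hx⟩ := hsurj ⟨w, hw⟩
      obtain ⟨a, ha, b, hb, hab⟩ := hdec j k hkj.symm x
      have hae : a = w := by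
        have h1 : φ x = ⟨a, ha⟩ := by
          simp only [φ, LinearMap.comp_apply, Submodule.subtype_apply, ← hab, map_add]
          rw [Submodule.projectionOnto_apply_of_mem_left hc1 ha, Submodule.projectionOnto_apply_of_mem_right hc1 hb]
          simp
        rw [hx] at h1
        exact (congrArg Subtype.val h1).symm
      rw [← hae]
      exact (hcomp j k hkj.symm a ha b hb (by rw [hab, hi _ x.2])).1
    refine ⟨c, fun v => ?_⟩
    obtain ⟨a, ha, b, hb, rfl⟩ := hdec 0 1 (by decide) v
    rw [map_add, hall 0 a ha, hall 1 b hb, smul_add]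
  choose p hp1 hp2 hp3 using hE
  -- eigenvectors in W i are multiples of p i
  have hmul : ∀ i, ∀ a ∈ W i, θ a = c • a → ∃ s : F, a = s • p i := by
    intro i a ha hea
    by_contra hno
    push Not at hno
    apply hfull i
    have hli : LinearIndependent F ![(⟨p i, hp1 i⟩ : W i), ⟨a, ha⟩] := by
      rw [LinearIndependent.pair_iff' (by simpa using hp2 i)]
      intro s hs
      exact hno s (congrArg Subtype.val hs).symm
    have hspan := hli.span_eq_top_of_card_eq_finrank (by simp [hdim])
    intro w hw
    have hm : (⟨w, hw⟩ : W i) ∈ Submodule.span F (Set.range ![(⟨p i, hp1 i⟩ : W i), ⟨a, ha⟩]) := by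
      rw [hspan]; trivial
    simp only [Matrix.range_cons, Matrix.range_empty, Set.union_empty, Set.singleton_union] at hm
    obtain ⟨s, t, hst⟩ := Submodule.mem_span_pair.1 hm
    have hst := congrArg Subtype.val hst
    simp at hst
    rw [← hst, map_add, map_smul, map_smul, hp3, hea, smul_add, smul_comm s, smul_comm t]
  refine ⟨p, fun i => ⟨hp1 i, hp2 i⟩, fun i => ?_⟩
  obtain ⟨a, ha, b, hb, hab⟩ := hdec 1 0 (by decide) (p i)
  obtain ⟨h1, h2⟩ := hcomp 1 0 (by decide) a ha b hb (by rw [hab, hp3])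
  obtain ⟨s, hs⟩ := hmul 1 a ha h1
  obtain ⟨t, ht⟩ := hmul 0 b hb h2
  exact ⟨s, t, by rw [← hab, ← hs, ← ht]⟩

end helpers

section config

variable {F V : Type*} [Field F] [AddCommGroup V] [Module F V]

/-- coefficient of `x ^ 2 y` -/
def cm2 (T : V →ₗ[F] V →ₗ[F] V →ₗ[F] F) (u v : V) : F := T u u v + T u v u + T v u u

/-- coefficient of `x y z` -/
def cm3 (T : V →ₗ[F] V →ₗ[F] V →ₗ[F] F) (u v w : V) : F :=
  T u v w + T u w v + T v u w + T v w u + T w u v + T w v u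

theorem expand2 (T : V →ₗ[F] V →ₗ[F] V →ₗ[F] F) (u v : V) (s t : F) :
    T (s • u + t • v) (s • u + t • v) (s • u + t • v) =
      T u u u * s ^ 3 + cm2 T u v * s ^ 2 * t + cm2 T v u * s * t ^ 2 + T v v v * t ^ 3 := by
  simp only [map_add, map_smul, LinearMap.add_apply, LinearMap.smul_apply, smul_eq_mul, cm2]
  ring

theorem expand4 (T : V →ₗ[F] V →ₗ[F] V →ₗ[F] F) (a b c d p : V) (x y z w : F)
    (hp : p = x • a + y • b + z • c + w • d) :
    T p p p =
      T a a a * x ^ 3 + T b b b * y ^ 3 + T c c c * z ^ 3 + T d d d * w ^ 3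
      + cm2 T a b * x ^ 2 * y + cm2 T a c * x ^ 2 * z + cm2 T a d * x ^ 2 * w
      + cm2 T b a * y ^ 2 * x + cm2 T b c * y ^ 2 * z + cm2 T b d * y ^ 2 * w
      + cm2 T c a * z ^ 2 * x + cm2 T c b * z ^ 2 * y + cm2 T c d * z ^ 2 * w
      + cm2 T d a * w ^ 2 * x + cm2 T d b * w ^ 2 * y + cm2 T d c * w ^ 2 * z
      + cm3 T a b c * x * y * z + cm3 T a b d * x * y * w
      + cm3 T a c d * x * z * w + cm3 T b c d * y * z * w := by
  subst hp
  simp only [map_add, map_smul, LinearMap.add_apply, LinearMap.smul_apply, smul_eq_mul, cm2, cm3]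
  ring

theorem expandgrad (T : V →ₗ[F] V →ₗ[F] V →ₗ[F] F) (a b c d p u : V) (x y z w s t : F)
    (hu : u = x • a + y • b + z • c + w • d) (hp : p = s • b + t • d) :
    T u p p + T p u p + T p p u =
      x * (cm2 T b a * s ^ 2 + cm3 T a b d * s * t + cm2 T d a * t ^ 2)
      + y * (3 * T b b b * s ^ 2 + 2 * cm2 T b d * s * t + cm2 T d b * t ^ 2)
      + z * (cm2 T b c * s ^ 2 + cm3 T b c d * s * t + cm2 T d c * t ^ 2)
      + w * (cm2 T b d * s ^ 2 + 2 * cm2 T d b * s * t + 3 * T d d d * t ^ 2) := by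
  subst hu hp
  simp only [map_add, map_smul, LinearMap.add_apply, LinearMap.smul_apply, smul_eq_mul, cm2, cm3]
  ring

theorem no_config [IsAlgClosed F] (T : V →ₗ[F] V →ₗ[F] V →ₗ[F] F)
    (hsm : ∀ v, v ≠ 0 → T v v v = 0 → ∃ u, T u v v + T v u v + T v v u ≠ 0)
    (p q : Fin 6 → V)
    (hind : ∀ i j, i ≠ j → ∀ a b c d : F, a • p i + b • q i + c • p j + d • q j = 0 →
      a = 0 ∧ b = 0 ∧ c = 0 ∧ d = 0)
    (hL : ∀ i, ∃ s t : F, p i = s • p 1 + t • p 0)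
    (hspan : ∀ v, ∃ x y z w : F, v = x • p 1 + y • p 0 + z • q 1 + w • q 0)
    (hz : ∀ i, ∀ s t : F, T (s • p i + t • q i) (s • p i + t • q i) (s • p i + t • q i) = 0) :
    False := by
  have : Infinite F := IsAlgClosed.instInfinite
  choose X Y hXY using hL
  choose R S z w hq using fun i => hspan (q i)
  -- coordinates of `p`
  have hdet : ∀ i j, i ≠ j → X i * Y j - X j * Y i ≠ 0 := by
    intro i j hij h
    have h1 := hind i j hij (X j) 0 (-X i) 0 (by
      rw [hXY i, hXY j]
      match_scalars <;> first | ring1 | linear_combination h | linear_combination -h)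
    have h2 := hind i j hij (Y j) 0 (-Y i) 0 (by
      rw [hXY i, hXY j]
      match_scalars <;> first | ring1 | linear_combination h | linear_combination -h)
    have h3 := hind i j hij 1 0 0 0 (by
      rw [hXY i, neg_eq_zero.1 h1.2.2.1, neg_eq_zero.1 h2.2.2.1]; simp)
    exact one_ne_zero h3.1
  have hne : ∀ i, X i ≠ 0 ∨ Y i ≠ 0 := by
    intro i
    by_contra! h
    obtain ⟨j, hj⟩ := exists_ne i
    exact hdet i j hj.symm (by rw [h.1, h.2]; ring)
  -- distinct planes
  have hzw : ∀ i j, i ≠ j → z i * w j - z j * w i ≠ 0 := by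
    intro i j hij h
    have hD := hdet i j hij
    set D := X i * Y j - X j * Y i with hDdef
    have key : ∀ s t : F, s * z i + t * z j = 0 → s * w i + t * w j = 0 → s = 0 ∧ t = 0 := by
      intro s t e1 e2
      have := hind i j hij
        (-((s * R i + t * R j) * Y j - X j * (s * S i + t * S j))) (D * s)
        (-(X i * (s * S i + t * S j) - (s * R i + t * R j) * Y i)) (D * t) (by
          rw [hXY i, hXY j, hq i, hq j]
          match_scalars
          · rw [hDdef]; ring
          · rw [hDdef]; ring
          · linear_combination D * e1
          · linear_combination D * e2)
      simpa [hD] using And.intro this.2.1 this.2.2.2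
    obtain ⟨h1, h2⟩ := key (w j) (-w i) (by linear_combination h) (by ring)
    obtain ⟨h3, h4⟩ := key (z j) (-z i) (by ring) (by linear_combination -h)
    have h5 := key 1 1 (by rw [h3, neg_eq_zero.1 h4]; ring) (by rw [h1, neg_eq_zero.1 h2]; ring)
    exact one_ne_zero h5.1
  -- coordinates for i = 0
  have hX0 : X 0 = 0 ∧ Y 0 = 1 := by
    have := hind 0 1 (by decide) (Y 0 - 1) 0 (X 0) 0 (by
      have := hXY 0
      rw [← sub_eq_zero] at this
      rw [← neg_eq_zero, ← this]
      module)
    exact ⟨this.2.2.1, sub_eq_zero.1 this.1⟩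
  have hX1 : X 1 = 1 ∧ Y 1 = 0 := by
    have := hind 0 1 (by decide) (Y 1) 0 (X 1 - 1) 0 (by
      have := hXY 1
      rw [← sub_eq_zero] at this
      rw [← neg_eq_zero, ← this]
      module)
    exact ⟨sub_eq_zero.1 this.2.2.1, this.1⟩
  have hzw0 : z 0 = 0 ∧ w 0 = 1 := by
    have := hind 0 1 (by decide) (S 0) (w 0 - 1) (R 0) (z 0) (by
      have := hq 0
      rw [← sub_eq_zero] at this
      rw [← neg_eq_zero, ← this]
      module)
    exact ⟨this.2.2.2, sub_eq_zero.1 this.2.1⟩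
  have hzne : ∀ i : Fin 5, z i.succ ≠ 0 := by
    intro i h
    apply hzw 0 i.succ (Fin.succ_ne_zero i).symm
    rw [hzw0.1, h]; ring
  -- vanishing on `W 0`
  obtain ⟨y3, y2w, yw2, w3⟩ := bincubic _ _ _ _ (fun s t => by
    exact (expand2 T (p 0) (q 0) s t).symm.trans (hz 0 s t))
  -- vanishing on the transversal
  have hpz : ∀ i, T (p i) (p i) (p i) = 0 := by
    intro i
    simpa using hz i 1 0
  have hline : ∀ i, cm2 T (p 1) (p 0) * X i ^ 2 * Y i + cm2 T (p 0) (p 1) * X i * Y i ^ 2 = 0 := by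
    intro i
    have h := hpz i
    rw [hXY i, expand2, hpz 0, hpz 1] at h
    linear_combination h
  have hXne : ∀ i, i ≠ 0 → X i ≠ 0 := by
    intro i hi h
    apply hdet 0 i hi.symm
    rw [hX0.1, h]; ring
  have hYne : ∀ i, i ≠ 1 → Y i ≠ 0 := by
    intro i hi h
    apply hdet 1 i hi.symm
    rw [hX1.2, h]; ring
  have hline2 : ∀ i, i ≠ 0 → i ≠ 1 →
      cm2 T (p 1) (p 0) * X i + cm2 T (p 0) (p 1) * Y i = 0 := by
    intro i h0 h1
    have h : (X i * Y i) * (cm2 T (p 1) (p 0) * X i + cm2 T (p 0) (p 1) * Y i) = 0 := by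
      linear_combination hline i
    simpa [hXne i h0, hYne i h1] using h
  have g2 := hline2 2 (by decide) (by decide)
  have g3 := hline2 3 (by decide) (by decide)
  have g23 := hdet 2 3 (by decide)
  have x2y : cm2 T (p 1) (p 0) = 0 := by
    apply (mul_eq_zero.1 (_ : cm2 T (p 1) (p 0) * (X 2 * Y 3 - X 3 * Y 2) = 0)).resolve_right g23
    linear_combination Y 3 * g2 - Y 2 * g3
  have xy2 : cm2 T (p 0) (p 1) = 0 := by
    apply (mul_eq_zero.1 (_ : cm2 T (p 0) (p 1) * (X 2 * Y 3 - X 3 * Y 2) = 0)).resolve_right g23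
    linear_combination X 2 * g3 - X 3 * g2
  have x3 := hpz 1
  refine final_alg (cm2 T (p 1) (q 0)) (cm3 T (p 1) (p 0) (q 0)) (cm2 T (q 0) (p 1))
    (cm2 T (p 1) (q 1)) (cm3 T (p 1) (p 0) (q 1)) (cm2 T (p 0) (q 1))
    (cm3 T (p 1) (q 1) (q 0)) (cm2 T (q 1) (p 1)) (cm3 T (p 0) (q 1) (q 0)) (cm2 T (q 1) (p 0))
    (cm2 T (q 0) (q 1)) (cm2 T (q 1) (q 0)) (T (q 1) (q 1) (q 1)) ?_
    (fun i => w i.succ / z i.succ) ?_ ?_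
  · intro y t hyt h1 h2
    obtain ⟨u, hu⟩ := hsm (y • p 0 + t • q 0) (by
      intro h
      have := hind 0 1 (by decide) y t 0 0 (by rw [h]; simp)
      rcases hyt with h' | h'
      · exact h' this.1
      · exact h' this.2.1) (hz 0 y t)
    apply hu
    obtain ⟨x', y', z', w', hu'⟩ := hspan u
    rw [expandgrad T _ _ _ _ _ u _ _ _ _ _ _ hu' rfl, xy2, y3, y2w, yw2, w3]
    linear_combination x' * h1 + z' * h2
  · intro i j h
    by_contra hij
    have h' : w i.succ / z i.succ = w j.succ / z j.succ := h
    rw [div_eq_div_iff (hzne i) (hzne j)] at h'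
    apply hzw i.succ j.succ (fun e => hij (Fin.succ_injective _ e))
    linear_combination -h'
  · intro i a b c d e h ha hb hc hd he hh
    have hzi := hzne i
    have hci : w i.succ = (w i.succ / z i.succ) * z i.succ := by field_simp
    generalize w i.succ / z i.succ = r at *
    obtain ⟨-, h1, h2, h3⟩ := bincubic 0
      (a * X i.succ ^ 2 + b * X i.succ * Y i.succ + c * Y i.succ ^ 2)
      (2 * a * (R i.succ / z i.succ) * X i.succ
        + b * ((R i.succ / z i.succ) * Y i.succ + (S i.succ / z i.succ) * X i.succ)
        + 2 * c * (S i.succ / z i.succ) * Y i.succ + d * X i.succ + e * Y i.succ)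
      (a * (R i.succ / z i.succ) ^ 2 + b * (R i.succ / z i.succ) * (S i.succ / z i.succ)
        + c * (S i.succ / z i.succ) ^ 2 + d * (R i.succ / z i.succ) + e * (S i.succ / z i.succ) + h)
      (fun s t => by
        have hv := hz i.succ s (t / z i.succ)
        rw [expand4 T (p 1) (p 0) (q 1) (q 0) _
          (s * X i.succ + t * (R i.succ / z i.succ)) (s * Y i.succ + t * (S i.succ / z i.succ))
          t (t * r) (by
            rw [hXY i.succ, hq i.succ, hci]
            match_scalars <;> field_simp), x3, y3, w3, x2y, xy2, y2w, yw2] at hv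
        subst ha hb hc hd he hh
        linear_combination hv)
    exact half_disc a b c d e h _ _ _ _ (hne i.succ) h1 h2 h3

end config

/-- Let `F` be an algebraically closed field and `f` a homogeneous cubic in four variables
cutting out a smooth cubic surface. Let `W₁, …, W₆` be six pairwise skew lines on the
surface (2-dimensional subspaces of `F⁴` meeting pairwise in `0` on which `f` vanishes).
If `θ ∈ GL₄(F)` satisfies `θ(Wᵢ) = Wᵢ` for all `i`, then `θ` is a scalar matrix. -/
theorem stmt_12 (F : Type*) [Field F] [IsAlgClosed F]
    (f : MvPolynomial (Fin 4) F) (hf : f.IsHomogeneous 3)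
    (hsmooth : ¬ ∃ v : Fin 4 → F, v ≠ 0 ∧ eval v f = 0 ∧ ∀ i, eval v (pderiv i f) = 0)
    (W : Fin 6 → Submodule F (Fin 4 → F))
    (hdim : ∀ i, Module.finrank F (W i) = 2)
    (hskew : ∀ i j, i ≠ j → W i ⊓ W j = ⊥)
    (hlines : ∀ i, ∀ w ∈ W i, eval w f = 0)
    (θ : (Matrix (Fin 4) (Fin 4) F)ˣ)
    (hθ : ∀ i, (W i).map (Matrix.mulVecLin (θ : Matrix (Fin 4) (Fin 4) F)) = W i) :
    ∃ c : F, (θ : Matrix (Fin 4) (Fin 4) F) = c • (1 : Matrix (Fin 4) (Fin 4) F) := by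
  rcases transversal (by simp) W hdim hskew (Matrix.mulVecLin (θ : Matrix (Fin 4) (Fin 4) F))
    (fun i w hw => by
      have := Submodule.mem_map_of_mem (f := Matrix.mulVecLin (θ : Matrix (Fin 4) (Fin 4) F)) hw
      rwa [hθ i] at this) with ⟨c, hc⟩ | ⟨p, hp, hL⟩
  · refine ⟨c, ?_⟩
    apply Matrix.mulVec_injective
    funext v
    have := hc v
    rw [Matrix.mulVecLin_apply] at this
    rw [this, Matrix.smul_mulVec, Matrix.one_mulVec]
  exfalso
  obtain ⟨T, hT1, hT2⟩ := cubic_trilinear f hf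
  -- second generator
  have hq : ∀ i, ∃ q ∈ W i, ∀ a b : F, a • p i + b • q = 0 → a = 0 ∧ b = 0 := by
    intro i
    have hp0 : (⟨p i, (hp i).1⟩ : W i) ≠ 0 := by simpa using (hp i).2
    obtain ⟨q, hq⟩ := exists_linearIndependent_pair_of_one_lt_finrank
      (by rw [hdim i]; norm_num) hp0
    refine ⟨q, q.2, fun a b h => LinearIndependent.pair_iff.1 hq a b (Subtype.ext ?_)⟩
    simpa using h
  choose q hq1 hq2 using hq
  have hind : ∀ i j, i ≠ j → ∀ a b c d : F, a • p i + b • q i + c • p j + d • q j = 0 →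
      a = 0 ∧ b = 0 ∧ c = 0 ∧ d = 0 := by
    intro i j hij a b c d h
    have hi : a • p i + b • q i ∈ W i :=
      add_mem ((W i).smul_mem _ (hp i).1) ((W i).smul_mem _ (hq1 i))
    have hj : c • p j + d • q j ∈ W j :=
      add_mem ((W j).smul_mem _ (hp j).1) ((W j).smul_mem _ (hq1 j))
    have e : a • p i + b • q i = -(c • p j + d • q j) := by
      rw [eq_neg_iff_add_eq_zero, ← h]; abel
    have h0 : a • p i + b • q i ∈ W i ⊓ W j := ⟨hi, by rw [e]; exact neg_mem hj⟩
    rw [hskew i j hij, Submodule.mem_bot] at h0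
    obtain ⟨h1, h2⟩ := hq2 i a b h0
    rw [h0] at e
    obtain ⟨h3, h4⟩ := hq2 j c d (neg_eq_zero.1 e.symm)
    exact ⟨h1, h2, h3, h4⟩
  refine no_config T ?_ p q hind hL ?_ ?_
  · intro v hv h0
    by_contra! h
    exact hsmooth ⟨v, hv, by rw [hT1, h0], fun i => by rw [hT2, h]⟩
  · have hli : LinearIndependent F ![p 1, p 0, q 1, q 0] := by
      rw [Fintype.linearIndependent_iff]
      intro g hg
      simp [Fin.sum_univ_four] at hg
      have := hind 1 0 (by decide) (g 0) (g 2) (g 1) (g 3) (by rw [← hg]; abel)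
      intro i
      fin_cases i
      · exact this.1
      · exact this.2.2.1
      · exact this.2.1
      · exact this.2.2.2
    have hspan := hli.span_eq_top_of_card_eq_finrank (by simp)
    intro v
    have hv : v ∈ Submodule.span F (Set.range ![p 1, p 0, q 1, q 0]) := by
      rw [hspan]; trivial
    obtain ⟨g, hg⟩ := (Submodule.mem_span_range_iff_exists_fun F).1 hv
    refine ⟨g 0, g 1, g 2, g 3, ?_⟩
    rw [← hg]
    simp [Fin.sum_univ_four]
  · intro i s t
    rw [← hT1]
    exact hlines i _ (add_mem ((W i).smul_mem _ (hp i).1) ((W i).smul_mem _ (hq1 i)))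
end
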